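/- arXiv:1209.0039 — 4 statements merged into one kernel-verified Lean document; each statement's English description precedes it below -/
import Mathlib

section
/- Let 0 < α < β ≤ 1/2. For every irreducible Markov chain on a finite state space, T(α) ≤ T(β) + (α⁻¹ − 1)·T(1−β) ≤ T(β)/α. -/
/-- `P` is a row-stochastic transition matrix on the finite state space `Ω`. -/
def IsTransitionMatrix {Ω : Type*} [Fintype Ω] (P : Matrix Ω Ω ℝ) : Prop :=
  (∀ x y, 0 ≤ P x y) ∧ ∀ x, ∑ y, P x y = 1

/-- The chain is irreducible: any state can reach any other state. -/
def IsIrreducibleChain {Ω : Type*} [Fintype Ω] [DecidableEq Ω] (P : Matrix Ω Ω ℝ) : Prop :=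
  ∀ x y, ∃ n : ℕ, 0 < (P ^ n) x y

/-- `π` is a stationary distribution for `P`. -/
def IsStationaryDist {Ω : Type*} [Fintype Ω] (P : Matrix Ω Ω ℝ) (π : Ω → ℝ) : Prop :=
  (∀ x, 0 ≤ π x) ∧ (∑ x, π x = 1) ∧ ∀ y, ∑ x, π x * P x y = π y

/-- The expected hitting time `E_x[τ_A] = ∑_{t=0}^∞ ∑_{y ∉ A} Qᵗ(x,y)`, where `Q` is `P`
with rows and columns indexed by `A` replaced by zero. -/
noncomputable def hitTime {Ω : Type*} [Fintype Ω] [DecidableEq Ω]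
    (P : Matrix Ω Ω ℝ) (A : Finset Ω) (x : Ω) : ℝ :=
  ∑' t : ℕ, ∑ y ∈ Aᶜ, (((Matrix.of fun u v => if u ∈ A ∨ v ∈ A then (0:ℝ) else P u v)) ^ t) x y

/-- `T(α)`: the maximum expected hitting time of a set of stationary measure at least `α`. -/
noncomputable def Tfun {Ω : Type*} [Fintype Ω] [DecidableEq Ω]
    (P : Matrix Ω Ω ℝ) (π : Ω → ℝ) (α : ℝ) : ℝ :=
  sSup {r | ∃ (x : Ω) (A : Finset Ω), α ≤ ∑ a ∈ A, π a ∧ r = hitTime P A x}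

/-- `d⁺(A,B) = max_{x ∈ A} E_x[τ_B]`. -/
noncomputable def dplus {Ω : Type*} [Fintype Ω] [DecidableEq Ω]
    (P : Matrix Ω Ω ℝ) (A B : Finset Ω) : ℝ :=
  sSup {r | ∃ x ∈ A, r = hitTime P B x}

/-- `d⁻(A,B) = min_{x ∈ A} E_x[τ_B]`. -/
noncomputable def dminus {Ω : Type*} [Fintype Ω] [DecidableEq Ω]
    (P : Matrix Ω Ω ℝ) (A B : Finset Ω) : ℝ :=
  sInf {r | ∃ x ∈ A, r = hitTime P B x}

/-- the killed matrix -/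
noncomputable def killed {Ω : Type*} [Fintype Ω] [DecidableEq Ω]
    (P : Matrix Ω Ω ℝ) (A : Finset Ω) : Matrix Ω Ω ℝ :=
  Matrix.of fun u v => if u ∈ A ∨ v ∈ A then (0:ℝ) else P u v

/-- survival probability -/
noncomputable def surv {Ω : Type*} [Fintype Ω] [DecidableEq Ω]
    (P : Matrix Ω Ω ℝ) (A : Finset Ω) (t : ℕ) (x : Ω) : ℝ :=
  ∑ y ∈ Aᶜ, (killed P A ^ t) x y

section helpers
variable {Ω : Type*} [Fintype Ω] [DecidableEq Ω] {P : Matrix Ω Ω ℝ}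

lemma hitTime_eq (A : Finset Ω) (x : Ω) : hitTime P A x = ∑' t, surv P A t x := rfl

lemma killed_nonneg (hP : IsTransitionMatrix P) (A : Finset Ω) (x y : Ω) : 0 ≤ killed P A x y := by
  unfold killed
  simp only [Matrix.of_apply]
  split_ifs
  · exact le_rfl
  · exact hP.1 x y

lemma killed_le (hP : IsTransitionMatrix P) (A : Finset Ω) (x y : Ω) :
    killed P A x y ≤ P x y := by
  unfold killed
  simp only [Matrix.of_apply]
  split_ifs
  · exact hP.1 x y
  · exact le_rfl

lemma killed_pow (hP : IsTransitionMatrix P) (A : Finset Ω) (t : ℕ) : ∀ x y,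
    0 ≤ (killed P A ^ t) x y ∧ (killed P A ^ t) x y ≤ (P ^ t) x y := by
  induction t with
  | zero =>
    intro x y
    simp only [pow_zero, le_refl, and_true, Matrix.one_apply]
    split_ifs <;> norm_num
  | succ t ih =>
    intro x y
    simp only [pow_succ, Matrix.mul_apply]
    constructor
    · exact Finset.sum_nonneg fun z _ => mul_nonneg (ih x z).1 (killed_nonneg hP A z y)
    · exact Finset.sum_le_sum fun z _ => mul_le_mul (ih x z).2 (killed_le hP A z y)
        (killed_nonneg hP A z y) ((ih x z).1.trans (ih x z).2)

lemma pow_row (hP : IsTransitionMatrix P) (t : ℕ) : ∀ x, ∑ y, (P ^ t) x y = 1 := by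
  induction t with
  | zero => intro x; simp [Matrix.one_apply]
  | succ t ih =>
    intro x
    simp only [pow_succ, Matrix.mul_apply]
    rw [Finset.sum_comm]
    simp only [← Finset.mul_sum, hP.2, mul_one, ih]

lemma surv_nonneg (hP : IsTransitionMatrix P) (A : Finset Ω) (t : ℕ) (x : Ω) :
    0 ≤ surv P A t x := Finset.sum_nonneg fun y _ => (killed_pow hP A t x y).1

lemma surv_le (hP : IsTransitionMatrix P) (A : Finset Ω) (t : ℕ) (x : Ω) :
    surv P A t x ≤ 1 - ∑ y ∈ A, (P ^ t) x y := by
  have h := Finset.sum_add_sum_compl A (fun y => (P ^ t) x y)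
  rw [pow_row hP t x] at h
  have : surv P A t x ≤ ∑ y ∈ Aᶜ, (P ^ t) x y :=
    Finset.sum_le_sum fun y _ => (killed_pow hP A t x y).2
  linarith

lemma P_pow_nonneg (hP : IsTransitionMatrix P) (t : ℕ) (x y : Ω) : 0 ≤ (P ^ t) x y :=
  (killed_pow hP ∅ t x y).1.trans (killed_pow hP ∅ t x y).2

lemma surv_le_one (hP : IsTransitionMatrix P) (A : Finset Ω) (t : ℕ) (x : Ω) :
    surv P A t x ≤ 1 := by
  have h := surv_le hP A t x
  have : 0 ≤ ∑ y ∈ A, (P ^ t) x y := Finset.sum_nonneg fun y _ => P_pow_nonneg hP t x y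
  linarith

lemma surv_mem (A : Finset Ω) (t : ℕ) (x : Ω) (hx : x ∈ A) : surv P A t x = 0 := by
  unfold surv
  apply Finset.sum_eq_zero
  intro y hy
  rw [Finset.mem_compl] at hy
  cases t with
  | zero =>
    rw [pow_zero, Matrix.one_apply_ne]
    rintro rfl; exact hy hx
  | succ t =>
    rw [pow_succ', Matrix.mul_apply]
    apply Finset.sum_eq_zero
    intro z _
    simp [killed, hx]

lemma surv_add (A : Finset Ω) (s t : ℕ) (x : Ω) :
    surv P A (s + t) x = ∑ z ∈ Aᶜ, (killed P A ^ s) x z * surv P A t z := by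
  have h1 : surv P A (s + t) x = ∑ z, (killed P A ^ s) x z * surv P A t z := by
    unfold surv
    simp only [pow_add, Matrix.mul_apply]
    rw [Finset.sum_comm]
    simp only [Finset.mul_sum]
  rw [h1]
  symm
  apply Finset.sum_subset (Finset.subset_univ _)
  intro z _ hz
  rw [surv_mem A t z (by simpa using hz), mul_zero]

lemma surv_zero (A : Finset Ω) (x : Ω) (hx : x ∉ A) : surv P A 0 x = 1 := by
  simp [surv, Matrix.one_apply, hx]

lemma surv_succ (A : Finset Ω) (t : ℕ) (x : Ω) (hx : x ∉ A) :
    surv P A (t + 1) x = ∑ z, P x z * surv P A t z := by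
  rw [add_comm, surv_add]
  rw [← Finset.sum_subset (Finset.subset_univ Aᶜ)]
  · apply Finset.sum_congr rfl
    intro z hz
    rw [Finset.mem_compl] at hz
    simp [killed, hx, hz]
  · intro z _ hz
    rw [surv_mem A t z (by simpa using hz), mul_zero]

lemma surv_anti (hP : IsTransitionMatrix P) (A : Finset Ω) (x : Ω) :
    Antitone (fun t => surv P A t x) := by
  apply antitone_nat_of_succ_le
  intro t
  rw [surv_add]
  unfold surv
  apply Finset.sum_le_sum
  intro z _
  have := surv_le_one hP A 1 z
  have h2 := (killed_pow hP A t x z).1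
  unfold surv at this
  nlinarith

lemma surv_summable [Nonempty Ω] (hP : IsTransitionMatrix P) (hirr : IsIrreducibleChain P)
    (A : Finset Ω) (hA : A.Nonempty) (x : Ω) : Summable (fun t => surv P A t x) := by
  obtain ⟨a, ha⟩ := hA
  choose n hn using fun x => hirr x a
  obtain ⟨N, hN⟩ : ∃ N, ∀ x, n x ≤ N :=
    ⟨Finset.univ.sup n, fun x => Finset.le_sup (Finset.mem_univ x)⟩
  have hlt : ∀ x, surv P A N x < 1 := by
    intro x
    have h1 := surv_anti hP A x (hN x)
    have h2 := surv_le hP A (n x) x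
    have h3 : (P ^ n x) x a ≤ ∑ y ∈ A, (P ^ n x) x y :=
      Finset.single_le_sum (f := fun y => (P ^ n x) x y)
        (fun y _ => P_pow_nonneg hP _ x y) ha
    have h4 := hn x
    simp only at h1
    linarith
  obtain ⟨x0, hx0⟩ := Finite.exists_max (fun x => surv P A N x)
  have hc := hlt x0
  set c := surv P A N x0
  apply summable_of_sum_range_le (c := N / (1 - c)) (fun t => surv_nonneg hP A t x)
  intro m
  obtain ⟨x1, hx1⟩ := Finite.exists_max (fun x => ∑ t ∈ Finset.range m, surv P A t x)
  refine (hx1 x).trans ?_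
  set U := ∑ t ∈ Finset.range m, surv P A t x1 with hU
  have hU0 : 0 ≤ U := Finset.sum_nonneg fun t _ => surv_nonneg hP A t x1
  have e1 : U ≤ ∑ t ∈ Finset.range (N + m), surv P A t x1 :=
    Finset.sum_le_sum_of_subset_of_nonneg (Finset.range_mono (by omega))
      fun t _ _ => surv_nonneg hP A t x1
  rw [Finset.sum_range_add] at e1
  have e2 : ∑ t ∈ Finset.range N, surv P A t x1 ≤ N := by
    have := Finset.sum_le_card_nsmul (Finset.range N) (fun t => surv P A t x1) 1
      (fun t _ => surv_le_one hP A t x1)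
    simpa using this
  have e3 : ∑ t ∈ Finset.range m, surv P A (N + t) x1 ≤ c * U := by
    simp only [surv_add]
    rw [Finset.sum_comm]
    simp only [← Finset.mul_sum]
    calc _ ≤ ∑ z ∈ Aᶜ, (killed P A ^ N) x1 z * U :=
          Finset.sum_le_sum fun z _ => mul_le_mul_of_nonneg_left (hx1 z) (killed_pow hP A N x1 z).1
      _ = surv P A N x1 * U := by rw [surv, Finset.sum_mul]
      _ ≤ c * U := mul_le_mul_of_nonneg_right (hx0 x1) hU0
  rw [le_div_iff₀ (by linarith)]
  linarith

lemma hitTime_nonneg (hP : IsTransitionMatrix P) (A : Finset Ω) (x : Ω) : 0 ≤ hitTime P A x := by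
  rw [hitTime_eq]
  exact tsum_nonneg fun t => surv_nonneg hP A t x

lemma hitTime_mem (A : Finset Ω) (x : Ω) (hx : x ∈ A) : hitTime P A x = 0 := by
  rw [hitTime_eq]
  simp [surv_mem A _ x hx]

lemma hitTime_step [Nonempty Ω] (hP : IsTransitionMatrix P) (hirr : IsIrreducibleChain P)
    (A : Finset Ω) (hA : A.Nonempty) (x : Ω) (hx : x ∉ A) :
    hitTime P A x = 1 + ∑ y, P x y * hitTime P A y := by
  simp only [hitTime_eq]
  rw [(surv_summable hP hirr A hA x).tsum_eq_zero_add, surv_zero A x hx]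
  simp only [surv_succ A _ x hx]
  rw [Summable.tsum_finsetSum fun y _ => (surv_summable hP hirr A hA y).mul_left _]
  simp only [tsum_mul_left]

lemma hitTime_le_super (hP : IsTransitionMatrix P)
    (A : Finset Ω) (w : Ω → ℝ) (hw0 : ∀ x, 0 ≤ w x)
    (hw : ∀ x, x ∉ A → 1 + ∑ y, P x y * w y ≤ w x) (x : Ω) : hitTime P A x ≤ w x := by
  rw [hitTime_eq]
  apply Real.tsum_le_of_sum_range_le (fun t => surv_nonneg hP A t x)
  intro m
  induction m generalizing x with
  | zero => simpa using hw0 x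
  | succ m ih =>
    by_cases hx : x ∈ A
    · simpa [surv_mem A _ x hx] using hw0 x
    · rw [Finset.sum_range_succ', surv_zero A x hx]
      simp only [surv_succ A _ x hx]
      rw [Finset.sum_comm]
      simp only [← Finset.mul_sum]
      have : ∑ y, P x y * ∑ t ∈ Finset.range m, surv P A t y ≤ ∑ y, P x y * w y :=
        Finset.sum_le_sum fun y _ => mul_le_mul_of_nonneg_left (ih y) (hP.1 x y)
      linarith [hw x hx]

lemma hitTime_comp [Nonempty Ω] (hP : IsTransitionMatrix P) (hirr : IsIrreducibleChain P)
    (A C : Finset Ω) (hA : A.Nonempty) (hC : C.Nonempty) (K : ℝ) (hK : 0 ≤ K)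
    (h : ∀ y ∈ C, hitTime P A y ≤ K) (x : Ω) : hitTime P A x ≤ hitTime P C x + K := by
  refine (hitTime_le_super hP A (fun x => min (hitTime P A x) (hitTime P C x + K)) ?_ ?_ x).trans
    (min_le_right _ _)
  · intro x
    exact le_min (hitTime_nonneg hP A x) (add_nonneg (hitTime_nonneg hP C x) hK)
  · intro x hx
    have h1 : ∑ y, P x y * min (hitTime P A y) (hitTime P C y + K) ≤ ∑ y, P x y * hitTime P A y :=
      Finset.sum_le_sum fun y _ => mul_le_mul_of_nonneg_left (min_le_left _ _) (hP.1 x y)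
    have h2 : ∑ y, P x y * min (hitTime P A y) (hitTime P C y + K)
        ≤ ∑ y, P x y * (hitTime P C y + K) :=
      Finset.sum_le_sum fun y _ => mul_le_mul_of_nonneg_left (min_le_right _ _) (hP.1 x y)
    simp only [mul_add, Finset.sum_add_distrib, ← Finset.sum_mul, hP.2, one_mul] at h2
    have h3 := hitTime_step hP hirr A hA x hx
    apply le_min
    · linarith
    · by_cases hxC : x ∈ C
      · linarith [h x hxC, hitTime_nonneg hP C x]
      · linarith [hitTime_step hP hirr C hC x hxC]

lemma key [Nonempty Ω] (hP : IsTransitionMatrix P) (hirr : IsIrreducibleChain P)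
    {π : Ω → ℝ} (hπ : IsStationaryDist P π)
    (A B : Finset Ω) (hA : A.Nonempty) (hB : B.Nonempty) (hAB : ∀ x ∈ B, x ∉ A)
    (D d : ℝ) (hD0 : 0 ≤ D) (hd0 : 0 ≤ d) (hD : ∀ x ∈ A, hitTime P B x ≤ D)
    (hd : ∀ x ∈ B, d ≤ hitTime P A x) :
    (D + d) * ∑ x ∈ A, π x ≤ D := by
  set f : Ω → ℝ := fun x => min (d * hitTime P B x) (D * (d - hitTime P A x)) with hf
  have hstep : ∀ x, (if x ∈ A then D + d else 0) - D ≤ f x - ∑ y, P x y * f y := by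
    intro x
    have h1 : ∑ y, P x y * f y ≤ ∑ y, P x y * (d * hitTime P B y) :=
      Finset.sum_le_sum fun y _ => mul_le_mul_of_nonneg_left (min_le_left _ _) (hP.1 x y)
    have h2 : ∑ y, P x y * f y ≤ ∑ y, P x y * (D * (d - hitTime P A y)) :=
      Finset.sum_le_sum fun y _ => mul_le_mul_of_nonneg_left (min_le_right _ _) (hP.1 x y)
    have e1 : ∑ y, P x y * (d * hitTime P B y) = d * ∑ y, P x y * hitTime P B y := by
      rw [Finset.mul_sum]; exact Finset.sum_congr rfl fun y _ => by ring
    have e2 : ∑ y, P x y * (D * (d - hitTime P A y)) = D * (d - ∑ y, P x y * hitTime P A y) := by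
      have : ∑ y, P x y * (D * (d - hitTime P A y))
          = D * d * ∑ y, P x y - D * ∑ y, P x y * hitTime P A y := by
        rw [Finset.mul_sum, Finset.mul_sum, ← Finset.sum_sub_distrib]
        exact Finset.sum_congr rfl fun y _ => by ring
      rw [this, hP.2]; ring
    rw [e1] at h1
    rw [e2] at h2
    by_cases hxA : x ∈ A
    · have hxB : x ∉ B := fun h => hAB x h hxA
      have s := hitTime_step hP hirr B hB x hxB
      have hfx : f x = d * hitTime P B x := by
        apply min_eq_left
        rw [hitTime_mem A x hxA]
        nlinarith [hD x hxA]
      rw [if_pos hxA, hfx]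
      have : d * hitTime P B x = d + d * ∑ y, P x y * hitTime P B y := by rw [s]; ring
      linarith
    · rw [if_neg hxA]
      have s := hitTime_step hP hirr A hA x hxA
      have t2 : ∑ y, P x y * f y ≤ D * (d - hitTime P A x) + D := by
        have : D * (d - hitTime P A x) + D = D * (d - ∑ y, P x y * hitTime P A y) := by
          rw [s]; ring
        linarith
      by_cases hxB : x ∈ B
      · have hfx : f x = D * (d - hitTime P A x) := by
          apply min_eq_right
          rw [hitTime_mem B x hxB]
          nlinarith [hd x hxB]
        rw [hfx]; linarith
      · have s' := hitTime_step hP hirr B hB x hxB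
        have : d * hitTime P B x = d + d * ∑ y, P x y * hitTime P B y := by rw [s']; ring
        rcases min_choice (d * hitTime P B x) (D * (d - hitTime P A x)) with h | h
        · have hfx : f x = d * hitTime P B x := h
          rw [hfx]; linarith
        · have hfx : f x = D * (d - hitTime P A x) := h
          rw [hfx]; linarith
  have hsum : ∑ x, π x * ((if x ∈ A then D + d else 0) - D)
      ≤ ∑ x, π x * (f x - ∑ y, P x y * f y) :=
    Finset.sum_le_sum fun x _ => mul_le_mul_of_nonneg_left (hstep x) (hπ.1 x)
  have hz : ∑ x, π x * (f x - ∑ y, P x y * f y) = 0 := by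
    simp only [mul_sub, Finset.sum_sub_distrib, Finset.mul_sum]
    rw [Finset.sum_comm, sub_eq_zero]
    apply Finset.sum_congr rfl
    intro y _
    simp only [← mul_assoc, ← Finset.sum_mul, hπ.2.2]
  rw [hz] at hsum
  simp only [mul_sub, Finset.sum_sub_distrib, ← Finset.sum_mul, hπ.2.1, mul_ite, mul_zero,
    Finset.sum_ite_mem, Finset.univ_inter] at hsum
  linarith

lemma Tset_bdd (π : Ω → ℝ) (α : ℝ) :
    BddAbove {r | ∃ (x : Ω) (A : Finset Ω), α ≤ ∑ a ∈ A, π a ∧ r = hitTime P A x} := by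
  apply Set.Finite.bddAbove
  apply (Set.finite_range (fun p : Ω × Finset Ω => hitTime P p.2 p.1)).subset
  rintro r ⟨x, A, -, rfl⟩
  exact ⟨(x, A), rfl⟩

lemma le_Tfun (π : Ω → ℝ) (α : ℝ) (x : Ω) (A : Finset Ω) (h : α ≤ ∑ a ∈ A, π a) :
    hitTime P A x ≤ Tfun P π α := le_csSup (Tset_bdd π α) ⟨x, A, h, rfl⟩

lemma Tfun_le [Nonempty Ω] {π : Ω → ℝ} (hπ : IsStationaryDist P π) (α K : ℝ) (hα : α ≤ 1)
    (h : ∀ x (A : Finset Ω), α ≤ ∑ a ∈ A, π a → hitTime P A x ≤ K) : Tfun P π α ≤ K := by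
  apply csSup_le
  · exact ⟨_, Classical.arbitrary Ω, Finset.univ, by rw [hπ.2.1]; exact hα, rfl⟩
  · rintro r ⟨x, A, hA, rfl⟩
    exact h x A hA

lemma Tfun_nonneg (hP : IsTransitionMatrix P) (π : Ω → ℝ) (α : ℝ) : 0 ≤ Tfun P π α := by
  apply Real.sSup_nonneg
  rintro r ⟨x, A, hA, rfl⟩
  exact hitTime_nonneg hP A x

end helpers

/-- For `0 < α < β ≤ 1/2` and every irreducible Markov chain on a finite state
space, `T(α) ≤ T(β) + (α⁻¹ − 1)·T(1−β) ≤ T(β)/α`. -/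
theorem hitting_time_ratio {Ω : Type*} [Fintype Ω] [DecidableEq Ω] [Nonempty Ω]
    (P : Matrix Ω Ω ℝ) (π : Ω → ℝ)
    (hP : IsTransitionMatrix P) (hirr : IsIrreducibleChain P) (hπ : IsStationaryDist P π)
    (α β : ℝ) (hα : 0 < α) (hαβ : α < β) (hβ : β ≤ 1/2) :
    Tfun P π α ≤ Tfun P π β + (α⁻¹ - 1) * Tfun P π (1 - β) ∧
    Tfun P π β + (α⁻¹ - 1) * Tfun P π (1 - β) ≤ Tfun P π β / α := by
  have hinv : 0 ≤ α⁻¹ - 1 := by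
    have := (one_le_inv₀ hα).2 (by linarith : α ≤ 1)
    linarith
  have hT0 := Tfun_nonneg hP π (1 - β)
  have hpos : ∀ (C : Finset Ω), 0 < ∑ a ∈ C, π a → C.Nonempty := by
    intro C hC
    by_contra hne
    rw [Finset.not_nonempty_iff_eq_empty] at hne
    simp [hne] at hC
  constructor
  · apply Tfun_le hπ α _ (by linarith)
    intro x A hA
    have hAne := hpos A (by linarith)
    set D := Tfun P π (1 - β) with hDdef
    set K := (α⁻¹ - 1) * D with hKdef
    have hK : 0 ≤ K := mul_nonneg hinv hT0
    set C : Finset Ω := Finset.univ.filter (fun y => hitTime P A y ≤ K) with hC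
    have hCmem : ∀ y, y ∈ C ↔ hitTime P A y ≤ K := by intro y; simp [hC]
    have hβC : β ≤ ∑ a ∈ C, π a := by
      by_contra hlt
      push Not at hlt
      have htot := Finset.sum_add_sum_compl C π
      rw [hπ.2.1] at htot
      have hBsum : 1 - β ≤ ∑ a ∈ Cᶜ, π a := by linarith
      have hBne := hpos Cᶜ (by linarith)
      obtain ⟨b, hb, hbmin⟩ := Finset.exists_min_image Cᶜ (fun y => hitTime P A y) hBne
      have hbK : K < hitTime P A b := by
        rw [Finset.mem_compl, hCmem] at hb
        exact not_le.1 hb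
      have hk := key hP hirr hπ A Cᶜ hAne hBne
        (by
          intro y hy hyA
          rw [Finset.mem_compl, hCmem, hitTime_mem A y hyA] at hy
          exact hy hK)
        D (hitTime P A b) hT0 (hitTime_nonneg hP A b)
        (fun y _ => le_Tfun π (1 - β) y Cᶜ hBsum) hbmin
      have h1 : (D + hitTime P A b) * α ≤ D :=
        (mul_le_mul_of_nonneg_left hA (add_nonneg hT0 (hitTime_nonneg hP A b))).trans hk
      have h2 : (D + K) * α = D := by
        rw [hKdef]; field_simp; ring
      have h3 : K * α < hitTime P A b * α := mul_lt_mul_of_pos_right hbK hα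
      linarith
    have := hitTime_comp hP hirr A C hAne (hpos C (by linarith)) K hK
      (fun y hy => (hCmem y).1 hy) x
    linarith [le_Tfun (P := P) π β x C hβC]
  · have hmono : Tfun P π (1 - β) ≤ Tfun P π β := by
      apply Tfun_le hπ _ _ (by linarith)
      intro x A hA
      exact le_Tfun π β x A (by linarith)
    have := mul_le_mul_of_nonneg_left hmono hinv
    rw [div_eq_mul_inv]
    linarith
end

section
/- There exists a universal constant c > 0 such that for every reversible, irreducible Markov chain on a finite state space with at least two states whose transition matrix P is lazy (P(x,x) ≥ 1/2 for all x), one has t_mix/c ≤ T(1/2) ≤ c·t_mix. -/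
/-- The (standard) mixing time
`t_mix = min{t : ∀ x ∈ Ω, ∀ A ⊆ Ω, |Pᵗ(x,A) − π(A)| ≤ 1/4}`. -/
noncomputable def tmix {Ω : Type*} [Fintype Ω] [DecidableEq Ω]
    (P : Matrix Ω Ω ℝ) (π : Ω → ℝ) : ℕ :=
  sInf {t : ℕ | ∀ (x : Ω) (A : Finset Ω), |∑ y ∈ A, (P ^ t) x y - ∑ y ∈ A, π y| ≤ 1/4}

set_option linter.unusedSectionVars false

namespace TMix

open Finset

variable {Ω : Type} [Fintype Ω] [DecidableEq Ω]

/-- The transition matrix killed on `A`. -/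
def killed (P : Matrix Ω Ω ℝ) (A : Finset Ω) : Matrix Ω Ω ℝ :=
  Matrix.of fun u v => if u ∈ A ∨ v ∈ A then (0:ℝ) else P u v

/-- The probability that `A` has not been hit by time `t`. -/
def surv (P : Matrix Ω Ω ℝ) (A : Finset Ω) (t : ℕ) (x : Ω) : ℝ :=
  ∑ y ∈ Aᶜ, (killed P A ^ t) x y

theorem hitTime_eq (P : Matrix Ω Ω ℝ) (A : Finset Ω) (x : Ω) :
    hitTime P A x = ∑' t, surv P A t x := rfl

theorem killed_nonneg {P : Matrix Ω Ω ℝ} (hP : IsTransitionMatrix P) (A : Finset Ω) (x y : Ω) :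
    0 ≤ killed P A x y := by
  simp only [killed, Matrix.of_apply]
  split_ifs
  · exact le_rfl
  · exact hP.1 x y

theorem killed_le {P : Matrix Ω Ω ℝ} (hP : IsTransitionMatrix P) (A : Finset Ω) (x y : Ω) :
    killed P A x y ≤ P x y := by
  simp only [killed, Matrix.of_apply]
  split_ifs
  · exact hP.1 x y
  · exact le_rfl

theorem killed_pow_nonneg {P : Matrix Ω Ω ℝ} (hP : IsTransitionMatrix P) (A : Finset Ω)
    (n : ℕ) (x y : Ω) : 0 ≤ (killed P A ^ n) x y := by
  induction n generalizing x y with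
  | zero => simp only [pow_zero, Matrix.one_apply]; split_ifs <;> norm_num
  | succ n ih =>
    rw [pow_succ', Matrix.mul_apply]
    exact Finset.sum_nonneg fun z _ => mul_nonneg (killed_nonneg hP A x z) (ih z y)

theorem killed_pow_le {P : Matrix Ω Ω ℝ} (hP : IsTransitionMatrix P) (A : Finset Ω)
    (n : ℕ) (x y : Ω) : (killed P A ^ n) x y ≤ (P ^ n) x y := by
  induction n generalizing x y with
  | zero => simp
  | succ n ih =>
    rw [pow_succ', pow_succ', Matrix.mul_apply, Matrix.mul_apply]
    exact Finset.sum_le_sum fun z _ => mul_le_mul (killed_le hP A x z) (ih z y)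
      (killed_pow_nonneg hP A n z y) (hP.1 x z)

theorem pow_row_sum {P : Matrix Ω Ω ℝ} (hP : IsTransitionMatrix P) (n : ℕ) (x : Ω) :
    ∑ y, (P ^ n) x y = 1 := by
  induction n generalizing x with
  | zero => simp [Matrix.one_apply]
  | succ n ih =>
    simp only [pow_succ', Matrix.mul_apply]
    rw [Finset.sum_comm]
    simp only [← Finset.mul_sum, ih, mul_one]
    exact hP.2 x

theorem surv_nonneg {P : Matrix Ω Ω ℝ} (hP : IsTransitionMatrix P) (A : Finset Ω)
    (n : ℕ) (x : Ω) : 0 ≤ surv P A n x :=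
  Finset.sum_nonneg fun y _ => killed_pow_nonneg hP A n x y

theorem surv_mem {P : Matrix Ω Ω ℝ} {A : Finset Ω} {x : Ω} (hx : x ∈ A) (n : ℕ) :
    surv P A n x = 0 := by
  unfold surv
  apply Finset.sum_eq_zero
  intro y hy
  have hy' : y ∉ A := by simpa using hy
  cases n with
  | zero =>
    have : x ≠ y := fun h => hy' (h ▸ hx)
    simp [this]
  | succ n =>
    rw [pow_succ', Matrix.mul_apply]
    apply Finset.sum_eq_zero
    intro z _
    simp [killed, hx]

theorem surv_zero {P : Matrix Ω Ω ℝ} {A : Finset Ω} {x : Ω} (hx : x ∉ A) :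
    surv P A 0 x = 1 := by
  unfold surv
  simp [Matrix.one_apply, hx]

theorem surv_add {P : Matrix Ω Ω ℝ} (A : Finset Ω) (n m : ℕ) (x : Ω) :
    surv P A (n + m) x = ∑ y ∈ Aᶜ, (killed P A ^ n) x y * surv P A m y := by
  have h1 : surv P A (n + m) x = ∑ y, (killed P A ^ n) x y * surv P A m y := by
    unfold surv
    simp only [pow_add, Matrix.mul_apply, Finset.mul_sum]
    rw [Finset.sum_comm]
  rw [h1]
  symm
  apply Finset.sum_subset (Finset.subset_univ _)
  intro y _ hy
  have : y ∈ A := by simpa using hy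
  rw [surv_mem this, mul_zero]

theorem surv_succ {P : Matrix Ω Ω ℝ} {A : Finset Ω} {x : Ω} (hx : x ∉ A) (n : ℕ) :
    surv P A (n + 1) x = ∑ y, P x y * surv P A n y := by
  rw [add_comm, surv_add, pow_one]
  have : ∑ y, P x y * surv P A n y = ∑ y ∈ Aᶜ, P x y * surv P A n y := by
    symm
    apply Finset.sum_subset (Finset.subset_univ _)
    intro y _ hy
    have : y ∈ A := by simpa using hy
    rw [surv_mem this, mul_zero]
  rw [this]
  apply Finset.sum_congr rfl
  intro y hy
  have hy' : y ∉ A := by simpa using hy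
  simp [killed, hx, hy']

theorem surv_le {P : Matrix Ω Ω ℝ} (hP : IsTransitionMatrix P) (A : Finset Ω) (n : ℕ) (x : Ω) :
    surv P A n x ≤ 1 - ∑ y ∈ A, (P ^ n) x y := by
  have h1 : surv P A n x ≤ ∑ y ∈ Aᶜ, (P ^ n) x y :=
    Finset.sum_le_sum fun y _ => killed_pow_le hP A n x y
  have h2 := pow_row_sum hP n x
  rw [← Finset.sum_add_sum_compl A] at h2
  linarith

theorem pow_nonneg' {P : Matrix Ω Ω ℝ} (hP : IsTransitionMatrix P) (n : ℕ) (x y : Ω) :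
    0 ≤ (P ^ n) x y :=
  (killed_pow_nonneg hP ∅ n x y).trans (killed_pow_le hP ∅ n x y)

theorem surv_le_one {P : Matrix Ω Ω ℝ} (hP : IsTransitionMatrix P) (A : Finset Ω) (n : ℕ) (x : Ω) :
    surv P A n x ≤ 1 := by
  have := surv_le hP A n x
  have : 0 ≤ ∑ y ∈ A, (P ^ n) x y := Finset.sum_nonneg fun y _ => pow_nonneg' hP n x y
  linarith

theorem surv_add_le {P : Matrix Ω Ω ℝ} (hP : IsTransitionMatrix P) (A : Finset Ω) (n m : ℕ) (x : Ω)
    {M : ℝ} (hM : ∀ y, surv P A m y ≤ M) :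
    surv P A (n + m) x ≤ surv P A n x * M := by
  rw [surv_add]
  conv_rhs => rw [surv, Finset.sum_mul]
  exact Finset.sum_le_sum fun y _ => mul_le_mul_of_nonneg_left (hM y) (killed_pow_nonneg hP A n x y)

theorem surv_antitone {P : Matrix Ω Ω ℝ} (hP : IsTransitionMatrix P) (A : Finset Ω) (x : Ω) :
    Antitone fun n => surv P A n x := by
  apply antitone_nat_of_succ_le
  intro n
  have := surv_add_le hP A n 1 x (surv_le_one hP A 1)
  simpa using this

theorem exists_surv_lt {P : Matrix Ω Ω ℝ} (hP : IsTransitionMatrix P) (hI : IsIrreducibleChain P)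
    {A : Finset Ω} (hA : A.Nonempty) : ∃ n, ∃ r : ℝ, r < 1 ∧ 0 ≤ r ∧ ∀ x, surv P A n x ≤ r := by
  obtain ⟨a, ha⟩ := hA
  choose k hk using fun x => hI x a
  let n := Finset.univ.sup k
  have hlt : ∀ x, surv P A n x < 1 := by
    intro x
    have h1 : surv P A n x ≤ surv P A (k x) x :=
      surv_antitone hP A x (Finset.le_sup (f := k) (Finset.mem_univ x))
    have h2 := surv_le hP A (k x) x
    have h3 : (P ^ k x) x a ≤ ∑ y ∈ A, (P ^ k x) x y :=
      Finset.single_le_sum (f := fun y => (P ^ k x) x y) (fun y _ => pow_nonneg' hP _ _ _) ha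
    have := hk x
    linarith
  have hne : (Finset.univ : Finset Ω).Nonempty := ⟨a, Finset.mem_univ a⟩
  obtain ⟨x0, -, hx0⟩ := Finset.exists_max_image Finset.univ (fun x => surv P A n x) hne
  exact ⟨n, surv P A n x0, hlt x0, surv_nonneg hP A n x0, fun x => hx0 x (Finset.mem_univ x)⟩

theorem surv_summable {P : Matrix Ω Ω ℝ} (hP : IsTransitionMatrix P) (hI : IsIrreducibleChain P)
    {A : Finset Ω} (hA : A.Nonempty) (x : Ω) : Summable fun n => surv P A n x := by
  obtain ⟨n, r, hr1, hr0, hr⟩ := exists_surv_lt hP hI hA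
  -- partial sums are bounded by n / (1 - r)
  have key : ∀ N, ∀ x, ∑ t ∈ Finset.range N, surv P A t x ≤ n / (1 - r) := by
    intro N
    induction N using Nat.strong_induction_on with
    | _ N ih =>
      intro x
      have h1r : 0 < 1 - r := by linarith
      by_cases hN : N ≤ n
      · calc ∑ t ∈ Finset.range N, surv P A t x ≤ ∑ t ∈ Finset.range N, (1:ℝ) :=
              Finset.sum_le_sum fun t _ => surv_le_one hP A t x
          _ = N := by simp
          _ ≤ n := by exact_mod_cast hN
          _ ≤ n / (1 - r) := by
            rw [le_div_iff₀ h1r]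
            have : (0:ℝ) ≤ n := Nat.cast_nonneg n
            nlinarith
      · push Not at hN
        rcases Nat.eq_zero_or_pos n with h0 | hpos
        · have hz : ∀ t, surv P A t x ≤ 0 := by
            have hle : ∀ k, ∀ t y, surv P A t y ≤ r ^ k := by
              intro k
              induction k with
              | zero => intro t y; simpa using surv_le_one hP A t y
              | succ k ihk =>
                intro t y
                have := surv_add_le hP A 0 t y (ihk t)
                rw [zero_add] at this
                refine this.trans ?_
                rw [pow_succ']
                have h0' := hr y
                rw [h0] at h0'
                exact mul_le_mul_of_nonneg_right h0' (pow_nonneg hr0 k)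
            intro t
            exact ge_of_tendsto (tendsto_pow_atTop_nhds_zero_of_lt_one hr0 hr1)
              (Filter.Eventually.of_forall fun k => hle k t x)
          calc ∑ t ∈ Finset.range N, surv P A t x ≤ 0 := Finset.sum_nonpos fun t _ => hz t
            _ ≤ n / (1 - r) := by positivity
        · obtain ⟨m, rfl⟩ := Nat.exists_eq_add_of_lt hN
          have hm : n + m + 1 = n + (m + 1) := by ring
          rw [hm, Finset.sum_range_add]
          have e1 : ∑ t ∈ Finset.range n, surv P A t x ≤ n := by
            calc ∑ t ∈ Finset.range n, surv P A t x ≤ ∑ t ∈ Finset.range n, (1:ℝ) :=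
              Finset.sum_le_sum fun t _ => surv_le_one hP A t x
              _ = n := by simp
          have e2 : ∑ t ∈ Finset.range (m + 1), surv P A (n + t) x ≤ r * (n / (1 - r)) := by
            simp only [surv_add]
            rw [Finset.sum_comm]
            simp only [← Finset.mul_sum]
            calc _ ≤ ∑ y ∈ Aᶜ, (killed P A ^ n) x y * (n / (1 - r)) :=
                  Finset.sum_le_sum fun y _ => mul_le_mul_of_nonneg_left
                    (ih (m + 1) (by omega) y) (killed_pow_nonneg hP A n x y)
              _ = surv P A n x * (n / (1 - r)) := by rw [← Finset.sum_mul]; rfl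
              _ ≤ _ := mul_le_mul_of_nonneg_right (hr x) (by positivity)
          have e3 : (n:ℝ) + r * (n / (1 - r)) = n / (1 - r) := by field_simp; ring
          linarith
  exact summable_of_sum_range_le (fun t => surv_nonneg hP A t x) (fun N => key N x)

theorem hitTime_nonneg {P : Matrix Ω Ω ℝ} (hP : IsTransitionMatrix P) (A : Finset Ω) (x : Ω) :
    0 ≤ hitTime P A x := tsum_nonneg fun t => surv_nonneg hP A t x

theorem hitTime_mem {P : Matrix Ω Ω ℝ} {A : Finset Ω} {x : Ω} (hx : x ∈ A) :
    hitTime P A x = 0 := by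
  rw [hitTime_eq]; simp [surv_mem hx]

theorem hitTime_step {P : Matrix Ω Ω ℝ} (hP : IsTransitionMatrix P) (hI : IsIrreducibleChain P)
    {A : Finset Ω} (hA : A.Nonempty) {x : Ω} (hx : x ∉ A) :
    hitTime P A x = 1 + ∑ y, P x y * hitTime P A y := by
  rw [hitTime_eq, (surv_summable hP hI hA x).tsum_eq_zero_add, surv_zero hx]
  congr 1
  simp only [surv_succ hx]
  rw [Summable.tsum_finsetSum fun y _ => (surv_summable hP hI hA y).mul_left _]
  apply Finset.sum_congr rfl
  intro y _
  rw [tsum_mul_left, hitTime_eq]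

/-- Markov inequality for the hitting time. -/
theorem mul_surv_le {P : Matrix Ω Ω ℝ} (hP : IsTransitionMatrix P) (hI : IsIrreducibleChain P)
    {A : Finset Ω} (hA : A.Nonempty) (x : Ω) (n : ℕ) : n * surv P A n x ≤ hitTime P A x := by
  calc n * surv P A n x = ∑ t ∈ Finset.range n, surv P A n x := by simp
    _ ≤ ∑ t ∈ Finset.range n, surv P A t x := Finset.sum_le_sum fun t ht =>
        surv_antitone hP A x (Finset.mem_range.1 ht).le
    _ ≤ _ := (surv_summable hP hI hA x).sum_le_tsum _ fun t _ => surv_nonneg hP A t x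

theorem hitTime_le {P : Matrix Ω Ω ℝ} (hP : IsTransitionMatrix P) (hI : IsIrreducibleChain P)
    {A : Finset Ω} (hA : A.Nonempty) (n : ℕ) (h : ∀ x, surv P A n x ≤ 3/4) (x : Ω) :
    hitTime P A x ≤ 4 * n := by
  obtain ⟨x0, -, hx0⟩ := Finset.exists_max_image Finset.univ (fun x => hitTime P A x)
    ⟨x, Finset.mem_univ x⟩
  have hs := surv_summable hP hI hA
  have e0 : hitTime P A x0 = ∑ t ∈ Finset.range n, surv P A t x0 + ∑' t, surv P A (t + n) x0 :=
    ((hs x0).sum_add_tsum_nat_add n).symm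
  have e1 : ∑ t ∈ Finset.range n, surv P A t x0 ≤ n := by
    calc ∑ t ∈ Finset.range n, surv P A t x0 ≤ ∑ t ∈ Finset.range n, (1:ℝ) :=
          Finset.sum_le_sum fun t _ => surv_le_one hP A t x0
      _ = n := by simp
  have e2 : ∑' t, surv P A (t + n) x0 ≤ 3/4 * hitTime P A x0 := by
    have : ∀ t, surv P A (t + n) x0 = ∑ y ∈ Aᶜ, (killed P A ^ n) x0 y * surv P A t y := by
      intro t; rw [add_comm, surv_add]
    simp only [this]
    rw [Summable.tsum_finsetSum fun y _ => (hs y).mul_left _]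
    simp only [tsum_mul_left, ← hitTime_eq]
    calc _ ≤ ∑ y ∈ Aᶜ, (killed P A ^ n) x0 y * hitTime P A x0 :=
          Finset.sum_le_sum fun y _ => mul_le_mul_of_nonneg_left
            (hx0 y (Finset.mem_univ y)) (killed_pow_nonneg hP A n x0 y)
      _ = surv P A n x0 * hitTime P A x0 := by rw [← Finset.sum_mul]; rfl
      _ ≤ _ := mul_le_mul_of_nonneg_right (h x0) (hitTime_nonneg hP A x0)
  have := hx0 x (Finset.mem_univ x)
  linarith

/-- Strong Markov decomposition at the hitting time of `G`. -/
theorem markov_decomp {P : Matrix Ω Ω ℝ} (hP : IsTransitionMatrix P) (G : Finset Ω) (f : Ω → ℝ)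
    (hf : ∀ s x, |((P ^ s).mulVec f) x| ≤ 1) {δ : ℝ} (hδ : 0 ≤ δ) (t : ℕ) (n : ℕ)
    (hG : ∀ x ∈ G, ∀ s, t ≤ s → s ≤ t + n → |((P ^ s).mulVec f) x| ≤ δ) (x : Ω) :
    |((P ^ (t + n)).mulVec f) x| ≤ δ + surv P G n x := by
  induction n generalizing x with
  | zero =>
    by_cases hx : x ∈ G
    · have := hG x hx t le_rfl le_rfl
      have h2 := surv_nonneg hP G 0 x
      simp only [add_zero]
      linarith
    · rw [surv_zero hx]
      have := hf (t + 0) x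
      linarith
  | succ n ih =>
    by_cases hx : x ∈ G
    · have := hG x hx (t + (n + 1)) (by omega) le_rfl
      have h2 := surv_nonneg hP G (n + 1) x
      linarith
    · rw [surv_succ hx, ← add_assoc, pow_succ', ← Matrix.mulVec_mulVec]
      have ih' := ih (fun x hx s h1 h2 => hG x hx s h1 (by omega))
      calc |(P.mulVec ((P ^ (t + n)).mulVec f)) x|
          = |∑ y, P x y * ((P ^ (t + n)).mulVec f) y| := rfl
        _ ≤ ∑ y, |P x y * ((P ^ (t + n)).mulVec f) y| := Finset.abs_sum_le_sum_abs _ _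
        _ ≤ ∑ y, P x y * (δ + surv P G n y) := Finset.sum_le_sum fun y _ => by
            rw [abs_mul, abs_of_nonneg (hP.1 x y)]
            exact mul_le_mul_of_nonneg_left (ih' y) (hP.1 x y)
        _ = _ := by
            simp only [mul_add, Finset.sum_add_distrib, ← Finset.sum_mul, hP.2 x, one_mul]

end TMix
namespace TMix

open Finset

variable {Ω : Type} [Fintype Ω] [DecidableEq Ω]

/-- The weighted inner product. -/
def ip (π f g : Ω → ℝ) : ℝ := ∑ x, π x * (f x * g x)

theorem ip_comm (π f g : Ω → ℝ) : ip π f g = ip π g f := by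
  unfold ip; simp only [mul_comm]

theorem ip_sub_left (π f g k : Ω → ℝ) : ip π (f - g) k = ip π f k - ip π g k := by
  unfold ip
  rw [← Finset.sum_sub_distrib]
  exact Finset.sum_congr rfl fun x _ => by simp only [Pi.sub_apply]; ring

theorem ip_sub_right (π f g k : Ω → ℝ) : ip π k (f - g) = ip π k f - ip π k g := by
  rw [ip_comm, ip_sub_left, ip_comm π f, ip_comm π g]

theorem ip_self_nonneg {π : Ω → ℝ} (h : ∀ x, 0 ≤ π x) (f : Ω → ℝ) : 0 ≤ ip π f f :=
  Finset.sum_nonneg fun x _ => mul_nonneg (h x) (mul_self_nonneg _)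

section rev

variable {P : Matrix Ω Ω ℝ} {π : Ω → ℝ}

theorem ip_adj (hrev : ∀ x y, π x * P x y = π y * P y x) (f g : Ω → ℝ) :
    ip π f (P.mulVec g) = ip π (P.mulVec f) g := by
  unfold ip Matrix.mulVec dotProduct
  simp only [Finset.mul_sum, Finset.sum_mul]
  rw [Finset.sum_comm]
  refine Finset.sum_congr rfl fun y _ => Finset.sum_congr rfl fun x _ => ?_
  linear_combination (f x * g y) * hrev x y

theorem sum_xy (f g : Ω → ℝ) :
    ∑ x, ∑ y, π x * P x y * (f x * g y) = ip π f (P.mulVec g) := by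
  unfold ip Matrix.mulVec dotProduct
  simp only [Finset.mul_sum]
  refine Finset.sum_congr rfl fun y _ => Finset.sum_congr rfl fun x _ => ?_
  ring

theorem sum_yx (hrev : ∀ x y, π x * P x y = π y * P y x) (f g : Ω → ℝ) :
    ∑ x, ∑ y, π x * P x y * (f y * g x) = ip π f (P.mulVec g) := by
  rw [← sum_xy, Finset.sum_comm]
  refine Finset.sum_congr rfl fun y _ => Finset.sum_congr rfl fun x _ => ?_
  rw [hrev x y]

theorem sum_xx (hP : IsTransitionMatrix P) (f g : Ω → ℝ) :
    ∑ x, ∑ y, π x * P x y * (f x * g x) = ip π f g := by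
  unfold ip
  refine Finset.sum_congr rfl fun x _ => ?_
  rw [← Finset.sum_mul, ← Finset.mul_sum, hP.2 x, mul_one]

theorem sum_yy (hπ : IsStationaryDist P π) (f g : Ω → ℝ) :
    ∑ x, ∑ y, π x * P x y * (f y * g y) = ip π f g := by
  unfold ip
  rw [Finset.sum_comm]
  refine Finset.sum_congr rfl fun x _ => ?_
  rw [← Finset.sum_mul, hπ.2.2 x]

/-- The Dirichlet form. -/
theorem dirichlet (hP : IsTransitionMatrix P) (hπ : IsStationaryDist P π)
    (hrev : ∀ x y, π x * P x y = π y * P y x) (f g : Ω → ℝ) :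
    2 * (ip π f g - ip π f (P.mulVec g)) =
      ∑ x, ∑ y, π x * P x y * ((f x - f y) * (g x - g y)) := by
  have h1 := sum_xx (π := π) hP f g
  have h2 := sum_yy hπ f g
  have h3 := sum_xy (P := P) (π := π) f g
  have h4 := sum_yx hrev f g
  have : ∑ x, ∑ y, π x * P x y * ((f x - f y) * (g x - g y)) =
      ∑ x, ∑ y, π x * P x y * (f x * g x) + ∑ x, ∑ y, π x * P x y * (f y * g y)
      - ∑ x, ∑ y, π x * P x y * (f x * g y) - ∑ x, ∑ y, π x * P x y * (f y * g x) := by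
    simp only [← Finset.sum_add_distrib, ← Finset.sum_sub_distrib]
    refine Finset.sum_congr rfl fun y _ => Finset.sum_congr rfl fun x _ => ?_
    ring
  rw [this, h1, h2, h3, h4]; ring

theorem dirichlet_nonneg (hP : IsTransitionMatrix P) (hπ : IsStationaryDist P π)
    (hrev : ∀ x y, π x * P x y = π y * P y x) (f : Ω → ℝ) :
    ip π f (P.mulVec f) ≤ ip π f f := by
  have h := dirichlet hP hπ hrev f f
  have : 0 ≤ ∑ x, ∑ y, π x * P x y * ((f x - f y) * (f x - f y)) :=
    Finset.sum_nonneg fun x _ => Finset.sum_nonneg fun y _ =>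
      mul_nonneg (mul_nonneg (hπ.1 x) (hP.1 x y)) (mul_self_nonneg _)
  linarith

theorem lazy_psd (hP : IsTransitionMatrix P) (hπ : IsStationaryDist P π)
    (hrev : ∀ x y, π x * P x y = π y * P y x) (hl : ∀ x, 1/2 ≤ P x x) (f : Ω → ℝ) :
    0 ≤ ip π f (P.mulVec f) := by
  have h1 := sum_xx (π := π) hP f f
  have h2 := sum_yy hπ f f
  have h3 := sum_xy (P := P) (π := π) f f
  have h4 := sum_yx hrev f f
  have e : ∑ x, ∑ y, π x * P x y * ((f x + f y) * (f x + f y)) =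
      ∑ x, ∑ y, π x * P x y * (f x * f x) + ∑ x, ∑ y, π x * P x y * (f y * f y)
      + ∑ x, ∑ y, π x * P x y * (f x * f y) + ∑ x, ∑ y, π x * P x y * (f y * f x) := by
    simp only [← Finset.sum_add_distrib]
    refine Finset.sum_congr rfl fun y _ => Finset.sum_congr rfl fun x _ => ?_
    ring
  have lower : 2 * ip π f f ≤ ∑ x, ∑ y, π x * P x y * ((f x + f y) * (f x + f y)) := by
    unfold ip
    rw [Finset.mul_sum]
    refine Finset.sum_le_sum fun x _ => ?_
    have : π x * P x x * ((f x + f x) * (f x + f x)) ≤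
        ∑ y, π x * P x y * ((f x + f y) * (f x + f y)) :=
      Finset.single_le_sum (f := fun y => π x * P x y * ((f x + f y) * (f x + f y)))
        (fun y _ => mul_nonneg (mul_nonneg (hπ.1 x) (hP.1 x y)) (mul_self_nonneg _))
        (Finset.mem_univ x)
    refine le_trans ?_ this
    have h5 : 0 ≤ π x * (f x * f x) * (P x x - 1/2) :=
      mul_nonneg (mul_nonneg (hπ.1 x) (mul_self_nonneg _)) (by linarith [hl x])
    nlinarith
  rw [e, h1, h2, h3, h4] at lower
  linarith

theorem contract (hP : IsTransitionMatrix P) (hπ : IsStationaryDist P π)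
    (hrev : ∀ x y, π x * P x y = π y * P y x) (hl : ∀ x, 1/2 ≤ P x x) (g : Ω → ℝ) :
    ip π (P.mulVec g) (P.mulVec g) ≤ ip π g (P.mulVec g) := by
  have h1 := lazy_psd hP hπ hrev hl (g - P.mulVec g)
  have h2 := dirichlet_nonneg hP hπ hrev (P.mulVec g)
  rw [Matrix.mulVec_sub, ip_sub_left, ip_sub_right, ip_sub_right] at h1
  have h3 := ip_adj hrev g (P.mulVec g)
  linarith

theorem picone {a b u v : ℝ} (hu : 0 ≤ u) (hv : 0 ≤ v) (ha : u = 0 → a = 0) (hb : v = 0 → b = 0) :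
    (a ^ 2 / u - b ^ 2 / v) * (u - v) ≤ (a - b) * (a - b) := by
  rcases hu.eq_or_lt with h | h
  · rw [← h, ha h.symm]
    rcases hv.eq_or_lt with h' | h'
    · rw [← h', hb h'.symm]; simp
    · have : b ^ 2 / v * v = b ^ 2 := div_mul_cancel₀ _ h'.ne'
      simp; nlinarith
  · rcases hv.eq_or_lt with h' | h'
    · rw [← h', hb h'.symm]
      have : a ^ 2 / u * u = a ^ 2 := div_mul_cancel₀ _ h.ne'
      simp; nlinarith
    · have key : (a - b) * (a - b) - (a ^ 2 / u - b ^ 2 / v) * (u - v) =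
          (a * v - b * u) ^ 2 / (u * v) := by
        field_simp; ring
      have : 0 ≤ (a * v - b * u) ^ 2 / (u * v) := by positivity
      linarith

/-- Poincaré inequality for functions vanishing on `A`. -/
theorem poincare_dirichlet (hP : IsTransitionMatrix P) (hI : IsIrreducibleChain P)
    (hπ : IsStationaryDist P π)
    (hrev : ∀ x y, π x * P x y = π y * P y x) {A : Finset Ω} (hA : A.Nonempty) {T : ℝ}
    (hT : ∀ x, hitTime P A x ≤ T) (g : Ω → ℝ) (hg : ∀ x ∈ A, g x = 0) :
    2 * ip π g g ≤ T * ∑ x, ∑ y, π x * P x y * ((g x - g y) * (g x - g y)) := by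
  set u : Ω → ℝ := fun x => hitTime P A x with hu
  have hu0 : ∀ x, 0 ≤ u x := fun x => hitTime_nonneg hP A x
  have hT0 : 0 ≤ T := by
    obtain ⟨a, ha⟩ := hA
    exact (hu0 a).trans (hT a)
  have hu1 : ∀ x, x ∉ A → 1 ≤ u x := by
    intro x hx
    have h1 : u x = _ := hitTime_step hP hI hA hx
    have : 0 ≤ ∑ y, P x y * hitTime P A y :=
      Finset.sum_nonneg fun y _ => mul_nonneg (hP.1 x y) (hu0 y)
    linarith
  have hz : ∀ x, u x = 0 → g x = 0 := by
    intro x hx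
    by_contra hne
    have : x ∉ A := fun h => hne (hg x h)
    have := hu1 x this
    linarith
  have h1 := dirichlet hP hπ hrev (fun x => g x ^ 2 / u x) u
  have h2 : ∑ x, ∑ y, π x * P x y * ((g x ^ 2 / u x - g y ^ 2 / u y) * (u x - u y)) ≤
      ∑ x, ∑ y, π x * P x y * ((g x - g y) * (g x - g y)) :=
    Finset.sum_le_sum fun x _ => Finset.sum_le_sum fun y _ => mul_le_mul_of_nonneg_left
      (picone (hu0 x) (hu0 y) (hz x) (hz y)) (mul_nonneg (hπ.1 x) (hP.1 x y))
  have h3 : ip π g g ≤ T * (ip π (fun x => g x ^ 2 / u x) u -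
      ip π (fun x => g x ^ 2 / u x) (P.mulVec u)) := by
    unfold ip
    rw [← Finset.sum_sub_distrib, Finset.mul_sum]
    refine Finset.sum_le_sum fun x _ => ?_
    by_cases hx : x ∈ A
    · simp [hg x hx]
    · have hs : u x = 1 + P.mulVec u x := hitTime_step hP hI hA hx
      have hpos : 0 < u x := by linarith [hu1 x hx]
      have e : T * (π x * (g x ^ 2 / u x * u x) - π x * (g x ^ 2 / u x * P.mulVec u x)) =
          T * (π x * (g x ^ 2 / u x)) := by
        rw [show P.mulVec u x = u x - 1 by linarith]; ring
      rw [e]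
      have e2 : π x * (g x * g x) = u x * (π x * (g x ^ 2 / u x)) := by
        field_simp
      rw [e2]
      exact mul_le_mul_of_nonneg_right (hT x) (mul_nonneg (hπ.1 x) (by positivity))
  have h4 := mul_le_mul_of_nonneg_left h2 hT0
  rw [← h1] at h4
  linarith

theorem exists_median (hπ0 : ∀ x, 0 ≤ π x) (hπ1 : ∑ x, π x = 1) (f : Ω → ℝ) :
    ∃ m : ℝ, 1/2 ≤ ∑ x with f x ≤ m, π x ∧ 1/2 ≤ ∑ x with m ≤ f x, π x := by
  classical
  have hne : (Finset.univ : Finset Ω).Nonempty := by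
    by_contra h
    rw [Finset.not_nonempty_iff_eq_empty] at h
    rw [h] at hπ1
    simp at hπ1
  let S : Finset Ω := Finset.univ.filter fun z => 1/2 ≤ ∑ x with f x ≤ f z, π x
  have hS : S.Nonempty := by
    obtain ⟨z, -, hz⟩ := Finset.exists_max_image Finset.univ f hne
    refine ⟨z, ?_⟩
    simp only [S, Finset.mem_filter, Finset.mem_univ, true_and]
    rw [Finset.filter_true_of_mem fun x hx => hz x hx, hπ1]
    norm_num
  obtain ⟨z, hzS, hz⟩ := Finset.exists_min_image S f hS
  have hzS' : 1/2 ≤ ∑ x with f x ≤ f z, π x := by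
    simpa only [S, Finset.mem_filter, Finset.mem_univ, true_and] using hzS
  refine ⟨f z, hzS', ?_⟩
  by_contra hcon
  push Not at hcon
  have hsplit := Finset.sum_filter_add_sum_filter_not Finset.univ (fun x => f z ≤ f x) π
  rw [hπ1] at hsplit
  have hlt : 1/2 < ∑ x with ¬ f z ≤ f x, π x := by linarith
  have hne2 : (Finset.univ.filter fun x => ¬ f z ≤ f x).Nonempty := by
    by_contra h
    rw [Finset.not_nonempty_iff_eq_empty] at h
    rw [h] at hlt
    simp at hlt
    linarith
  obtain ⟨w, hwS, hw⟩ := Finset.exists_max_image _ f hne2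
  have hwz : f w < f z := by
    have := (Finset.mem_filter.1 hwS).2
    exact lt_of_not_ge this
  have : w ∈ S := by
    simp only [S, Finset.mem_filter, Finset.mem_univ, true_and]
    refine hlt.le.trans ?_
    refine Finset.sum_le_sum_of_subset_of_nonneg ?_ fun x _ _ => hπ0 x
    intro x hx
    simp only [Finset.mem_filter, Finset.mem_univ, true_and]
    exact hw x hx
  have := hz w this
  linarith

theorem nonempty_of_half {A : Finset Ω} (h : 1/2 ≤ ∑ x ∈ A, π x) : A.Nonempty := by
  by_contra h'
  rw [Finset.not_nonempty_iff_eq_empty] at h'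
  rw [h'] at h
  norm_num at h

theorem posneg (a b : ℝ) : (max a 0 - max b 0) * (max a 0 - max b 0)
    + (max (-a) 0 - max (-b) 0) * (max (-a) 0 - max (-b) 0) ≤ (a - b) * (a - b) := by
  rcases le_total a 0 with ha | ha <;> rcases le_total b 0 with hb | hb
  · rw [max_eq_right ha, max_eq_right hb, max_eq_left (by linarith), max_eq_left (by linarith)]
    nlinarith
  · rw [max_eq_right ha, max_eq_left hb, max_eq_left (by linarith), max_eq_right (by linarith)]
    nlinarith
  · rw [max_eq_left ha, max_eq_right hb, max_eq_right (by linarith), max_eq_left (by linarith)]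
    nlinarith
  · rw [max_eq_left ha, max_eq_left hb, max_eq_right (by linarith), max_eq_right (by linarith)]
    nlinarith

/-- Poincaré inequality. -/
theorem poincare (hP : IsTransitionMatrix P) (hI : IsIrreducibleChain P)
    (hπ : IsStationaryDist P π)
    (hrev : ∀ x y, π x * P x y = π y * P y x) {T : ℝ} (hT0 : 0 ≤ T)
    (hT : ∀ A : Finset Ω, 1/2 ≤ ∑ x ∈ A, π x → ∀ x, hitTime P A x ≤ T) (f : Ω → ℝ)
    (hf : ∑ x, π x * f x = 0) :
    ip π f f ≤ T * (ip π f f - ip π f (P.mulVec f)) := by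
  obtain ⟨m, h1, h2⟩ := exists_median hπ.1 hπ.2.1 f
  set g1 : Ω → ℝ := fun x => max (f x - m) 0 with hg1
  set g2 : Ω → ℝ := fun x => max (-(f x - m)) 0 with hg2
  have p1 := poincare_dirichlet hP hI hπ hrev (nonempty_of_half h1) (hT _ h1) g1 (by
    intro x hx
    have := (Finset.mem_filter.1 hx).2
    exact max_eq_right (by linarith))
  have p2 := poincare_dirichlet hP hI hπ hrev (nonempty_of_half h2) (hT _ h2) g2 (by
    intro x hx
    have := (Finset.mem_filter.1 hx).2
    exact max_eq_right (by linarith))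
  have e1 : ip π f f ≤ ip π g1 g1 + ip π g2 g2 := by
    have hs : ∀ x, g1 x * g1 x + g2 x * g2 x = (f x - m) * (f x - m) := by
      intro x
      simp only [hg1, hg2]
      rcases le_total (f x - m) 0 with ha | ha
      · rw [max_eq_right ha, max_eq_left (by linarith)]; ring
      · rw [max_eq_left ha, max_eq_right (by linarith)]; ring
    have : ip π g1 g1 + ip π g2 g2 = ip π f f - 2 * m * ∑ x, π x * f x + m ^ 2 * ∑ x, π x := by
      unfold ip
      rw [Finset.mul_sum, Finset.mul_sum, ← Finset.sum_add_distrib, ← Finset.sum_sub_distrib,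
        ← Finset.sum_add_distrib]
      refine Finset.sum_congr rfl fun x _ => ?_
      rw [← mul_add, hs x]; ring
    rw [this, hf, hπ.2.1]
    nlinarith [sq_nonneg m]
  have e2 : ∑ x, ∑ y, π x * P x y * ((g1 x - g1 y) * (g1 x - g1 y))
      + ∑ x, ∑ y, π x * P x y * ((g2 x - g2 y) * (g2 x - g2 y))
      ≤ ∑ x, ∑ y, π x * P x y * ((f x - f y) * (f x - f y)) := by
    simp only [← Finset.sum_add_distrib]
    refine Finset.sum_le_sum fun x _ => Finset.sum_le_sum fun y _ => ?_
    rw [← mul_add]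
    refine mul_le_mul_of_nonneg_left ?_ (mul_nonneg (hπ.1 x) (hP.1 x y))
    have := posneg (f x - m) (f y - m)
    simp only [hg1, hg2]
    refine this.trans (le_of_eq ?_)
    ring
  have h5 := dirichlet hP hπ hrev f f
  have h6 := mul_le_mul_of_nonneg_left e2 hT0
  rw [← h5] at h6
  linarith

end rev

end TMix
namespace TMix

open Finset

variable {Ω : Type} [Fintype Ω] [DecidableEq Ω]

theorem weighted_sum_le (a : ℕ → ℝ) (h0 : ∀ k, a (k + 1) ≤ a k) (hpos : ∀ k, 0 ≤ a (2 * k))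
    (h2 : ∀ k, a (k + 1) - a (k + 2) ≤ a k - a (k + 1)) (N : ℕ) :
    ∑ s ∈ Finset.range N, ((s:ℝ) + 1) * (a (2 * s) - 2 * a (2 * s + 1) + a (2 * s + 2)) ≤ a 0 := by
  have key : ∑ s ∈ Finset.range N, ((s:ℝ) + 1) * (a (2 * s) - 2 * a (2 * s + 1) + a (2 * s + 2))
      ≤ a 0 - a (2 * N) - 2 * N * (a (2 * N) - a (2 * N + 1)) := by
    induction N with
    | zero => simp
    | succ N ih =>
      rw [Finset.sum_range_succ]
      have e1 := h2 (2 * N)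
      have e2 := h2 (2 * N + 1)
      have hN : (0:ℝ) ≤ N := Nat.cast_nonneg N
      rw [show 2 * (N + 1) = 2 * N + 2 by ring, show 2 * N + 2 + 1 = 2 * N + 3 by ring]
      rw [show 2 * N + 1 + 1 = 2 * N + 2 by ring, show 2 * N + 1 + 2 = 2 * N + 3 by ring] at e2
      push_cast
      have f1 := mul_le_mul_of_nonneg_left e1 hN
      have f2 := mul_le_mul_of_nonneg_left e2 hN
      nlinarith
  have h3 := hpos N
  have h4 := h0 (2 * N)
  have hN : (0:ℝ) ≤ N := Nat.cast_nonneg N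
  have : 0 ≤ 2 * N * (a (2 * N) - a (2 * N + 1)) := mul_nonneg (by linarith) (by linarith)
  linarith

section rev

variable {P : Matrix Ω Ω ℝ} {π : Ω → ℝ}

theorem h_succ (f : Ω → ℝ) (s : ℕ) :
    (P ^ (s + 1)).mulVec f = P.mulVec ((P ^ s).mulVec f) := by
  rw [pow_succ', ← Matrix.mulVec_mulVec]

theorem ip_pow (hrev : ∀ x y, π x * P x y = π y * P y x) (f : Ω → ℝ) (i j : ℕ) :
    ip π ((P ^ i).mulVec f) ((P ^ j).mulVec f) = ip π f ((P ^ (i + j)).mulVec f) := by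
  induction i generalizing j with
  | zero => simp
  | succ i ih =>
    rw [h_succ, ← ip_adj hrev, ← h_succ, ih, show i + (j + 1) = i + 1 + j by ring]

theorem mean_zero (hπ : IsStationaryDist P π) (f : Ω → ℝ) (hf : ∑ x, π x * f x = 0) (s : ℕ) :
    ∑ x, π x * (P ^ s).mulVec f x = 0 := by
  induction s with
  | zero => simpa using hf
  | succ s ih =>
    rw [h_succ, ← ih]
    generalize (P ^ s).mulVec f = g
    simp only [Matrix.mulVec, dotProduct, Finset.mul_sum]
    rw [Finset.sum_comm]
    refine Finset.sum_congr rfl fun y _ => ?_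
    simp only [← mul_assoc, ← Finset.sum_mul]
    rw [hπ.2.2 y]

/-- Existence of a good set of starting points. -/
theorem good_set (hP : IsTransitionMatrix P) (hI : IsIrreducibleChain P)
    (hπ : IsStationaryDist P π)
    (hrev : ∀ x y, π x * P x y = π y * P y x) (hl : ∀ x, 1/2 ≤ P x x) {T : ℝ} (hT0 : 1 ≤ T)
    (hT : ∀ A : Finset Ω, 1/2 ≤ ∑ x ∈ A, π x → ∀ x, hitTime P A x ≤ T) (f : Ω → ℝ)
    (hf : ∑ x, π x * f x = 0) (hf1 : ip π f f ≤ 1) (t n : ℕ) (ht : 2 ^ 18 * T ≤ t) :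
    ∃ G : Finset Ω, 1/2 ≤ ∑ x ∈ G, π x ∧
      ∀ x ∈ G, ∀ s, t ≤ s → s ≤ t + n → |(P ^ s).mulVec f x| ≤ 1/8 := by
  set h : ℕ → Ω → ℝ := fun s => (P ^ s).mulVec f with hh
  set a : ℕ → ℝ := fun k => ip π f (h k) with ha
  have hs : ∀ s, h (s + 1) = P.mulVec (h s) := fun s => h_succ f s
  have hip : ∀ i j, ip π (h i) (h j) = a (i + j) := fun i j => ip_pow hrev f i j
  have aE : ∀ k, 0 ≤ a (2 * k) := fun k => by
    rw [two_mul, ← hip]; exact ip_self_nonneg hπ.1 _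
  have aM : ∀ k, a (k + 1) ≤ a k := by
    intro k
    obtain ⟨m, rfl | rfl⟩ := Nat.even_or_odd' k
    · have := dirichlet_nonneg hP hπ hrev (h m)
      rw [← hs, hip, hip] at this
      rw [show 2 * m + 1 = m + (m + 1) by ring, two_mul]; exact this
    · have := contract hP hπ hrev hl (h m)
      rw [← hs, hip, hip] at this
      rw [show 2 * m + 1 + 1 = m + 1 + (m + 1) by ring, show 2 * m + 1 = m + (m + 1) by ring]
      exact this
  have diffE : ∀ m, ip π (h (m + 1) - h m) (h (m + 1) - h m)
      = a (2 * m) - 2 * a (2 * m + 1) + a (2 * m + 2) := by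
    intro m
    rw [ip_sub_left, ip_sub_right, ip_sub_right, hip, hip, hip, hip,
      show m + 1 + (m + 1) = 2 * m + 2 by ring, show m + 1 + m = 2 * m + 1 by ring,
      show m + (m + 1) = 2 * m + 1 by ring, show m + m = 2 * m by ring]
    ring
  have aC : ∀ k, a (k + 1) - a (k + 2) ≤ a k - a (k + 1) := by
    intro k
    obtain ⟨m, rfl | rfl⟩ := Nat.even_or_odd' k
    · have h1 := ip_self_nonneg hπ.1 (h (m + 1) - h m)
      rw [diffE] at h1
      linarith
    · have := lazy_psd hP hπ hrev hl (h (m + 1) - h m)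
      rw [Matrix.mulVec_sub, ← hs, ← hs, ip_sub_left, ip_sub_right, ip_sub_right,
        hip, hip, hip, hip, show m + 1 + (m + 1 + 1) = 2 * m + 1 + 2 by ring,
        show m + 1 + (m + 1) = 2 * m + 1 + 1 by ring,
        show m + (m + 1 + 1) = 2 * m + 1 + 1 by ring, show m + (m + 1) = 2 * m + 1 by ring] at this
      linarith
  have a0 : a 0 ≤ 1 := by simpa [ha, hh] using hf1
  have W := weighted_sum_le a aM aE aC
  have Tnn : 0 ≤ T := by linarith
  have poin : ∀ s, a (2 * s) ≤ T * (a (2 * s) - a (2 * (s + 1))) := by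
    intro s
    have := poincare hP hI hπ hrev Tnn hT (h s) (mean_zero hπ f hf s)
    rw [← hs, hip, hip, show s + s = 2 * s by ring, show s + (s + 1) = 2 * s + 1 by ring] at this
    refine this.trans (mul_le_mul_of_nonneg_left ?_ Tnn)
    have := aM (2 * s + 1)
    rw [show 2 * (s + 1) = 2 * s + 1 + 1 by ring]
    linarith
  have S : ∀ N, ∑ s ∈ Finset.range N, a (2 * s) ≤ T := by
    intro N
    calc ∑ s ∈ Finset.range N, a (2 * s)
        ≤ ∑ s ∈ Finset.range N, T * (a (2 * s) - a (2 * (s + 1))) :=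
          Finset.sum_le_sum fun s _ => poin s
      _ = T * (a (2 * 0) - a (2 * N)) := by
          rw [← Finset.mul_sum, Finset.sum_range_sub' (fun s => a (2 * s))]
      _ ≤ T * 1 := mul_le_mul_of_nonneg_left (by have := aE N; simp only [mul_zero]; linarith) Tnn
      _ = T := mul_one T
  have aAnti : Antitone a := antitone_nat_of_succ_le aM
  have tpos : (0:ℝ) < t := by nlinarith
  have at_le : a (2 * t) ≤ 1 / 2 ^ 18 := by
    have h1 : (t:ℝ) * a (2 * t) ≤ T := by
      calc (t:ℝ) * a (2 * t) = ∑ s ∈ Finset.range t, a (2 * t) := by simp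
        _ ≤ ∑ s ∈ Finset.range t, a (2 * s) := Finset.sum_le_sum fun s hs' =>
            aAnti (by have := Finset.mem_range.1 hs'; omega)
        _ ≤ T := S t
    have h2 := mul_le_mul_of_nonneg_right ht (aE t)
    by_contra hc
    push Not at hc
    have : T * (1 / 2 ^ 18) < T * a (2 * t) := mul_lt_mul_of_pos_left hc (by linarith)
    nlinarith
  -- the maximal function
  set M : Ω → ℝ := fun x => h t x ^ 2 +
    ∑ j ∈ Finset.range n, |h (t + j + 1) x ^ 2 - h (t + j) x ^ 2| with hM
  have M0 : ∀ x, 0 ≤ M x := fun x =>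
    add_nonneg (sq_nonneg _) (Finset.sum_nonneg fun j _ => abs_nonneg _)
  have Mmax : ∀ x, ∀ i, i ≤ n → h (t + i) x ^ 2 ≤ M x := by
    intro x i hi
    have h1 : h (t + i) x ^ 2 ≤ h t x ^ 2 +
        ∑ j ∈ Finset.range i, |h (t + j + 1) x ^ 2 - h (t + j) x ^ 2| := by
      clear hi
      induction i with
      | zero => simp
      | succ i ih =>
        rw [Finset.sum_range_succ]
        have := le_abs_self (h (t + i + 1) x ^ 2 - h (t + i) x ^ 2)
        rw [← add_assoc t i 1]
        linarith
    refine h1.trans ?_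
    simp only [hM]
    gcongr
  have term : ∀ j, ∑ x, π x * |h (t + j + 1) x ^ 2 - h (t + j) x ^ 2| ≤
      1 / 512 * ((((t + j : ℕ) : ℝ) + 1) *
        (a (2 * (t + j)) - 2 * a (2 * (t + j) + 1) + a (2 * (t + j) + 2)))
      + 512 / t * a (2 * (t + j)) := by
    intro j
    set k := t + j with hk
    have kt : (t:ℝ) ≤ (k:ℝ) + 1 := by
      have : (t:ℝ) ≤ k := by exact_mod_cast Nat.le_add_right t j
      linarith
    rw [← diffE]
    have pw : ∀ x, π x * |h (k + 1) x ^ 2 - h k x ^ 2| ≤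
        1 / 512 * (((k:ℝ) + 1) * (π x * ((h (k + 1) - h k) x * (h (k + 1) - h k) x)))
        + 256 / t * (π x * (h (k + 1) x * h (k + 1) x) + π x * (h k x * h k x)) := by
      intro x
      simp only [Pi.sub_apply]
      set p := h (k + 1) x
      set q := h k x
      have hx := hπ.1 x
      have am : |p ^ 2 - q ^ 2| ≤ 1 / 512 * (t * ((p - q) * (p - q))) + 256 / t * (p * p + q * q) := by
        have h1 : 2 * (|p - q| * |p + q|) ≤ 1 / 256 * t * |p - q| ^ 2 + 256 / t * |p + q| ^ 2 := by
          have e : 1 / 256 * t * |p - q| ^ 2 + 256 / t * |p + q| ^ 2 - 2 * (|p - q| * |p + q|)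
              = (t * |p - q| - 256 * |p + q|) ^ 2 / (256 * t) := by
            field_simp; ring
          have : 0 ≤ (t * |p - q| - 256 * |p + q|) ^ 2 / (256 * t) := by positivity
          linarith
        rw [sq_abs, sq_abs] at h1
        have h2 : |p ^ 2 - q ^ 2| = |p - q| * |p + q| := by
          rw [← abs_mul]; congr 1; ring
        have h3 : 256 / (t:ℝ) * (p + q) ^ 2 ≤ 256 / t * (2 * (p * p + q * q)) :=
          mul_le_mul_of_nonneg_left (by nlinarith [sq_nonneg (p - q)]) (by positivity)
        rw [h2]
        nlinarith
      have am2 : (t:ℝ) * ((p - q) * (p - q)) ≤ ((k:ℝ) + 1) * ((p - q) * (p - q)) :=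
        mul_le_mul_of_nonneg_right kt (mul_self_nonneg _)
      have am3 : |p ^ 2 - q ^ 2| ≤ 1 / 512 * (((k:ℝ) + 1) * ((p - q) * (p - q)))
          + 256 / t * (p * p + q * q) := by linarith
      refine (mul_le_mul_of_nonneg_left am3 hx).trans (le_of_eq ?_)
      ring
    have sm := Finset.sum_le_sum fun x (_ : x ∈ (Finset.univ : Finset Ω)) => pw x
    rw [Finset.sum_add_distrib, ← Finset.mul_sum, ← Finset.mul_sum, ← Finset.mul_sum,
      Finset.sum_add_distrib] at sm
    change _ ≤ 1 / 512 * (((k:ℝ) + 1) * ip π (h (k + 1) - h k) (h (k + 1) - h k)) +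
      256 / t * (ip π (h (k + 1)) (h (k + 1)) + ip π (h k) (h k)) at sm
    refine sm.trans ?_
    rw [hip, hip]
    have l1 : a (k + 1 + (k + 1)) ≤ a (2 * k) := aAnti (by omega)
    have l2 : a (k + k) = a (2 * k) := by rw [two_mul]
    rw [l2]
    have : 256 / (t:ℝ) * (a (k + 1 + (k + 1)) + a (2 * k)) ≤ 256 / t * (2 * a (2 * k)) :=
      mul_le_mul_of_nonneg_left (by linarith) (by positivity)
    have e : 256 / (t:ℝ) * (2 * a (2 * k)) = 512 / t * a (2 * k) := by ring
    linarith
  have EM : ∑ x, π x * M x ≤ 1 / 128 := by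
    have e : ∑ x, π x * M x = ip π (h t) (h t) +
        ∑ j ∈ Finset.range n, ∑ x, π x * |h (t + j + 1) x ^ 2 - h (t + j) x ^ 2| := by
      rw [Finset.sum_comm]
      unfold ip
      rw [← Finset.sum_add_distrib]
      refine Finset.sum_congr rfl fun x _ => ?_
      simp only [hM]
      rw [mul_add, Finset.mul_sum]; ring
    rw [e, hip, ← two_mul]
    have s1 := Finset.sum_le_sum fun j (_ : j ∈ Finset.range n) => term j
    rw [Finset.sum_add_distrib, ← Finset.mul_sum, ← Finset.mul_sum] at s1
    have s2 : ∑ j ∈ Finset.range n, (((t + j : ℕ) : ℝ) + 1) *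
        (a (2 * (t + j)) - 2 * a (2 * (t + j) + 1) + a (2 * (t + j) + 2)) ≤ 1 := by
      have w1 := W (t + n)
      rw [Finset.sum_range_add] at w1
      have : 0 ≤ ∑ s ∈ Finset.range t,
          ((s:ℝ) + 1) * (a (2 * s) - 2 * a (2 * s + 1) + a (2 * s + 2)) :=
        Finset.sum_nonneg fun s _ => mul_nonneg (by positivity) (by have := aC (2 * s); linarith)
      linarith
    have s3 : ∑ j ∈ Finset.range n, a (2 * (t + j)) ≤ T := by
      have w1 := S (t + n)
      rw [Finset.sum_range_add] at w1
      have : 0 ≤ ∑ s ∈ Finset.range t, a (2 * s) := Finset.sum_nonneg fun s _ => aE s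
      linarith
    have s4 : 512 / (t:ℝ) * ∑ j ∈ Finset.range n, a (2 * (t + j)) ≤ 1 / 512 := by
      calc _ ≤ 512 / (t:ℝ) * T := mul_le_mul_of_nonneg_left s3 (by positivity)
        _ = 512 * T / t := by ring
        _ ≤ 1 / 512 := by
          rw [div_le_iff₀ tpos]
          norm_num at ht ⊢
          linarith
    norm_num at at_le s1 s4 ⊢
    norm_num at s2
    linarith
  classical
  refine ⟨Finset.univ.filter fun x => M x ≤ 1 / 64, ?_, ?_⟩
  · have hsplit := Finset.sum_filter_add_sum_filter_not Finset.univ (fun x => M x ≤ 1 / 64) π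
    rw [hπ.2.1] at hsplit
    have hbad : 1 / 64 * ∑ x with ¬ M x ≤ 1 / 64, π x ≤ 1 / 128 := by
      refine le_trans ?_ EM
      rw [Finset.mul_sum]
      calc _ ≤ ∑ x with ¬ M x ≤ 1 / 64, π x * M x := Finset.sum_le_sum fun x hx => by
            have := lt_of_not_ge (Finset.mem_filter.1 hx).2
            have := mul_le_mul_of_nonneg_left this.le (hπ.1 x)
            linarith
        _ ≤ _ := Finset.sum_le_sum_of_subset_of_nonneg (Finset.subset_univ _)
            fun x _ _ => mul_nonneg (hπ.1 x) (M0 x)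
    linarith
  · intro x hx s h1 h2
    obtain ⟨i, rfl⟩ := Nat.exists_eq_add_of_le h1
    have e1 := Mmax x i (by omega)
    have e2 := (Finset.mem_filter.1 hx).2
    have e3 : h (t + i) x ^ 2 ≤ (1 / 8) ^ 2 := by norm_num; linarith
    exact abs_le_of_sq_le_sq e3 (by norm_num)

theorem mixing (hP : IsTransitionMatrix P) (hI : IsIrreducibleChain P)
    (hπ : IsStationaryDist P π)
    (hrev : ∀ x y, π x * P x y = π y * P y x) (hl : ∀ x, 1/2 ≤ P x x) {T : ℝ} (hT0 : 1 ≤ T)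
    (hT : ∀ A : Finset Ω, 1/2 ≤ ∑ x ∈ A, π x → ∀ x, hitTime P A x ≤ T) (t n : ℕ)
    (ht : 2 ^ 18 * T ≤ t) (hn : 8 * T ≤ n) (x : Ω) (A : Finset Ω) :
    |∑ y ∈ A, (P ^ (t + n)) x y - ∑ y ∈ A, π y| ≤ 1/4 := by
  set c := ∑ y ∈ A, π y with hc
  have c0 : 0 ≤ c := Finset.sum_nonneg fun y _ => hπ.1 y
  have c1 : c ≤ 1 := by
    rw [← hπ.2.1]
    exact Finset.sum_le_sum_of_subset_of_nonneg (Finset.subset_univ _) fun y _ _ => hπ.1 y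
  set f : Ω → ℝ := fun y => (if y ∈ A then 1 else 0) - c with hf
  have hval : ∀ s y, (P ^ s).mulVec f y = ∑ z ∈ A, (P ^ s) y z - c := by
    intro s y
    simp only [Matrix.mulVec, dotProduct, hf, mul_sub, Finset.sum_sub_distrib, ← Finset.sum_mul,
      pow_row_sum hP]
    simp
  have hb : ∀ s y, |(P ^ s).mulVec f y| ≤ 1 := by
    intro s y
    rw [hval]
    have p0 : 0 ≤ ∑ z ∈ A, (P ^ s) y z := Finset.sum_nonneg fun z _ => pow_nonneg' hP s y z
    have p1 : ∑ z ∈ A, (P ^ s) y z ≤ 1 := by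
      rw [← pow_row_sum hP s y]
      exact Finset.sum_le_sum_of_subset_of_nonneg (Finset.subset_univ _)
        fun z _ _ => pow_nonneg' hP s y z
    rw [abs_le]; constructor <;> linarith
  have hmean : ∑ y, π y * f y = 0 := by
    simp only [hf, mul_sub, Finset.sum_sub_distrib, ← Finset.sum_mul, hπ.2.1]
    simp [hc]
  have hf1 : ip π f f ≤ 1 := by
    rw [← hπ.2.1]
    refine Finset.sum_le_sum fun y _ => ?_
    have h1 : |f y| ≤ 1 := by simpa using hb 0 y
    have h2 : f y * f y ≤ 1 := by
      rw [← abs_mul_abs_self]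
      nlinarith [abs_nonneg (f y)]
    have := mul_le_mul_of_nonneg_left h2 (hπ.1 y)
    linarith
  obtain ⟨G, hG1, hG2⟩ := good_set hP hI hπ hrev hl hT0 hT f hmean hf1 t n ht
  have key := markov_decomp hP G f hb (by norm_num : (0:ℝ) ≤ 1/8) t n hG2 x
  rw [hval] at key
  have m1 := mul_surv_le hP hI (nonempty_of_half hG1) x n
  have m2 := hT G hG1 x
  have m3 : surv P G n x ≤ 1 / 8 := by
    by_contra hcon
    push Not at hcon
    have : 8 * T * surv P G n x ≤ n * surv P G n x :=
      mul_le_mul_of_nonneg_right hn (surv_nonneg hP G n x)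
    nlinarith
  linarith

end rev

end TMix

/-- There is a universal constant `c > 0` such that for every reversible,
irreducible, lazy finite Markov chain with at least two states,
`t_mix/c ≤ T(1/2) ≤ c·t_mix`. -/
theorem T_half_equiv_tmix :
    ∃ c : ℝ, 0 < c ∧
      ∀ (Ω : Type) [Fintype Ω] [DecidableEq Ω],
        ∀ (P : Matrix Ω Ω ℝ) (π : Ω → ℝ),
          2 ≤ Fintype.card Ω →
          IsTransitionMatrix P → IsIrreducibleChain P → IsStationaryDist P π →
          (∀ x y, π x * P x y = π y * P y x) →
          (∀ x, 1/2 ≤ P x x) →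
          (tmix P π : ℝ) / c ≤ Tfun P π (1/2) ∧ Tfun P π (1/2) ≤ c * tmix P π := by
  classical
  refine ⟨2 ^ 19, by norm_num, ?_⟩
  intro Ω _ _ P π hcard hP hI hπ hrev hl
  set T := Tfun P π (1/2) with hTdef
  have hbdd : BddAbove {r | ∃ (x : Ω) (A : Finset Ω), (1/2 : ℝ) ≤ ∑ a ∈ A, π a ∧
      r = hitTime P A x} := by
    refine Set.Finite.bddAbove ((Set.finite_range
      fun p : Ω × Finset Ω => hitTime P p.2 p.1).subset ?_)
    rintro r ⟨x, A, -, rfl⟩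
    exact ⟨(x, A), rfl⟩
  have hT : ∀ A : Finset Ω, 1/2 ≤ ∑ x ∈ A, π x → ∀ x, hitTime P A x ≤ T :=
    fun A hA x => le_csSup hbdd ⟨x, A, hA, rfl⟩
  -- a state of mass at most one half
  obtain ⟨x0, hx0⟩ : ∃ x0, π x0 ≤ 1/2 := by
    by_contra hcon
    push Not at hcon
    obtain ⟨a, b, hab⟩ := Fintype.exists_pair_of_one_lt_card (α := Ω) (by omega)
    have h1 : ∑ y ∈ ({a, b} : Finset Ω), π y ≤ 1 := by
      rw [← hπ.2.1]
      exact Finset.sum_le_sum_of_subset_of_nonneg (Finset.subset_univ _) fun y _ _ => hπ.1 y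
    rw [Finset.sum_pair hab] at h1
    linarith [hcon a, hcon b]
  have hA0 : 1/2 ≤ ∑ y ∈ ({x0}ᶜ : Finset Ω), π y := by
    have := Finset.sum_add_sum_compl {x0} π
    rw [hπ.2.1, Finset.sum_singleton] at this
    linarith
  have hx0A : x0 ∉ ({x0}ᶜ : Finset Ω) := by simp
  have hT1 : 1 ≤ T := by
    refine le_trans ?_ (hT _ hA0 x0)
    rw [TMix.hitTime_step hP hI (TMix.nonempty_of_half hA0) hx0A]
    have : 0 ≤ ∑ y, P x0 y * hitTime P ({x0}ᶜ : Finset Ω) y :=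
      Finset.sum_nonneg fun y _ => mul_nonneg (hP.1 x0 y) (TMix.hitTime_nonneg hP _ y)
    linarith
  have hmix := TMix.mixing hP hI hπ hrev hl hT1 hT ⌈2 ^ 18 * T⌉₊ ⌈8 * T⌉₊
    (Nat.le_ceil _) (Nat.le_ceil _)
  constructor
  · have h1 : tmix P π ≤ ⌈2 ^ 18 * T⌉₊ + ⌈8 * T⌉₊ := Nat.sInf_le hmix
    have h2 : (tmix P π : ℝ) ≤ (⌈2 ^ 18 * T⌉₊ : ℝ) + (⌈8 * T⌉₊ : ℝ) := by exact_mod_cast h1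
    have h3 := Nat.ceil_lt_add_one (show 0 ≤ 2 ^ 18 * T by positivity)
    have h4 := Nat.ceil_lt_add_one (show 0 ≤ 8 * T by positivity)
    rw [div_le_iff₀ (by norm_num)]
    norm_num at h2 h3 h4 ⊢
    linarith
  · have hmem : ∀ (x : Ω) (A : Finset Ω),
        |∑ y ∈ A, (P ^ tmix P π) x y - ∑ y ∈ A, π y| ≤ 1/4 :=
      Nat.sInf_mem (s := {t : ℕ | ∀ (x : Ω) (A : Finset Ω),
        |∑ y ∈ A, (P ^ t) x y - ∑ y ∈ A, π y| ≤ 1/4}) ⟨_, hmix⟩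
    have h4 : T ≤ 4 * tmix P π := by
      refine csSup_le ⟨_, x0, _, hA0, rfl⟩ ?_
      rintro r ⟨x, A, hA, rfl⟩
      refine TMix.hitTime_le hP hI (TMix.nonempty_of_half hA) _ (fun y => ?_) x
      have h5 := TMix.surv_le hP A (tmix P π) y
      have h6 := (abs_le.1 (hmem y A)).1
      linarith
    have : (0:ℝ) ≤ tmix P π := Nat.cast_nonneg _
    norm_num
    linarith
end

section
/- There exists a universal constant c > 0 such that for every irreducible Markov chain on a finite state space with at least two states, t_Ces/c ≤ T(1/2) ≤ c·t_Ces. -/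
/-- The Cèsaro mixing time
`t_Ces = min{t ≥ 1 : ∀ x ∈ Ω, ∀ A ⊆ Ω, |(1/t)∑_{s=0}^{t−1} Pˢ(x,A) − π(A)| ≤ 1/4}`. -/
noncomputable def tCes {Ω : Type*} [Fintype Ω] [DecidableEq Ω]
    (P : Matrix Ω Ω ℝ) (π : Ω → ℝ) : ℕ :=
  sInf {t : ℕ | 1 ≤ t ∧ ∀ (x : Ω) (A : Finset Ω),
    |(∑ s ∈ Finset.range t, ∑ y ∈ A, (P ^ s) x y) / t - ∑ y ∈ A, π y| ≤ 1/4}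

namespace CesHit

open Finset

variable {Ω : Type} [Fintype Ω] [DecidableEq Ω]

/-- the killed transition matrix -/
noncomputable def Q (P : Matrix Ω Ω ℝ) (A : Finset Ω) : Matrix Ω Ω ℝ :=
  Matrix.of fun u v => if u ∈ A ∨ v ∈ A then (0:ℝ) else P u v

/-- survival probability -/
noncomputable def S (P : Matrix Ω Ω ℝ) (A : Finset Ω) (n : ℕ) (x : Ω) : ℝ :=
  ∑ y ∈ Aᶜ, (Q P A ^ n) x y

noncomputable def W (P : Matrix Ω Ω ℝ) (A : Finset Ω) (n : ℕ) (x : Ω) : ℝ :=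
  ∑ s ∈ range n, S P A s x

theorem hitTime_eq (P : Matrix Ω Ω ℝ) (A : Finset Ω) (x : Ω) :
    hitTime P A x = ∑' t, S P A t x := rfl

theorem S_add (P : Matrix Ω Ω ℝ) (A : Finset Ω) (m n : ℕ) (x : Ω) :
    S P A (m + n) x = ∑ y, (Q P A ^ m) x y * S P A n y := by
  unfold S
  rw [pow_add]
  simp only [Matrix.mul_apply, mul_sum]
  rw [sum_comm]

theorem S_succ (P : Matrix Ω Ω ℝ) (A : Finset Ω) (n : ℕ) (x : Ω) :
    S P A (n + 1) x = ∑ y, Q P A x y * S P A n y := by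
  rw [add_comm, S_add, pow_one]

theorem S_zero (P : Matrix Ω Ω ℝ) (A : Finset Ω) (x : Ω) :
    S P A 0 x = if x ∈ A then 0 else 1 := by
  unfold S
  simp [Matrix.one_apply]

theorem S_mem (P : Matrix Ω Ω ℝ) (A : Finset Ω) (n : ℕ) (x : Ω) (hx : x ∈ A) :
    S P A n x = 0 := by
  cases n with
  | zero => simp [S_zero, hx]
  | succ n => rw [S_succ]; simp [Q, hx]

theorem S_succ_not (P : Matrix Ω Ω ℝ) (A : Finset Ω) (n : ℕ) (x : Ω) (hx : x ∉ A) :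
    S P A (n + 1) x = ∑ y, P x y * S P A n y := by
  rw [S_succ]
  refine sum_congr rfl fun y _ => ?_
  by_cases hy : y ∈ A
  · simp [S_mem P A n y hy]
  · simp [Q, hx, hy]

theorem W_mem (P : Matrix Ω Ω ℝ) (A : Finset Ω) (n : ℕ) (x : Ω) (hx : x ∈ A) :
    W P A n x = 0 := by
  simp [W, S_mem P A _ x hx]

theorem W_succ_not (P : Matrix Ω Ω ℝ) (A : Finset Ω) (n : ℕ) (x : Ω) (hx : x ∉ A) :
    W P A (n + 1) x = 1 + ∑ y, P x y * W P A n y := by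
  unfold W
  rw [sum_range_succ', S_zero, if_neg hx, add_comm]
  congr 1
  simp only [S_succ_not P A _ x hx, mul_sum]
  rw [sum_comm]

theorem Qpow_nonneg {P : Matrix Ω Ω ℝ} (hP : IsTransitionMatrix P) (A : Finset Ω) (n : ℕ)
    (x y : Ω) : 0 ≤ (Q P A ^ n) x y := by
  induction n generalizing x y with
  | zero => simp only [pow_zero, Matrix.one_apply]; split_ifs <;> norm_num
  | succ n ih =>
    rw [pow_succ, Matrix.mul_apply]
    refine sum_nonneg fun z _ => mul_nonneg (ih _ _) ?_
    simp only [Q, Matrix.of_apply]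
    split_ifs
    · exact le_rfl
    · exact hP.1 _ _

theorem S_nonneg {P : Matrix Ω Ω ℝ} (hP : IsTransitionMatrix P) (A : Finset Ω) (n : ℕ)
    (x : Ω) : 0 ≤ S P A n x := sum_nonneg fun _ _ => Qpow_nonneg hP A n x _

theorem S_anti_step {P : Matrix Ω Ω ℝ} (hP : IsTransitionMatrix P) (A : Finset Ω) (n : ℕ)
    (x : Ω) : S P A (n + 1) x ≤ S P A n x := by
  induction n generalizing x with
  | zero =>
    by_cases hx : x ∈ A
    · rw [S_mem _ _ _ _ hx, S_mem _ _ _ _ hx]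
    · rw [S_succ_not _ _ _ _ hx, S_zero, if_neg hx, ← hP.2 x]
      refine sum_le_sum fun y _ => ?_
      rw [S_zero]
      split_ifs
      · simpa using hP.1 x y
      · simp
  | succ n ih =>
    by_cases hx : x ∈ A
    · rw [S_mem _ _ _ _ hx, S_mem _ _ _ _ hx]
    · rw [S_succ_not _ _ _ _ hx, S_succ_not _ _ _ _ hx]
      exact sum_le_sum fun y _ => mul_le_mul_of_nonneg_left (ih y) (hP.1 x y)

theorem S_anti {P : Matrix Ω Ω ℝ} (hP : IsTransitionMatrix P) (A : Finset Ω) (x : Ω) :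
    Antitone fun n => S P A n x := antitone_nat_of_succ_le fun n => S_anti_step hP A n x

theorem S_le_one {P : Matrix Ω Ω ℝ} (hP : IsTransitionMatrix P) (A : Finset Ω) (n : ℕ)
    (x : Ω) : S P A n x ≤ 1 := by
  refine (S_anti hP A x (Nat.zero_le n)).trans ?_
  simp only [S_zero]
  split_ifs <;> norm_num

theorem Ppow_trans {P : Matrix Ω Ω ℝ} (hP : IsTransitionMatrix P) (n : ℕ) :
    IsTransitionMatrix (P ^ n) := by
  induction n with
  | zero =>
    refine ⟨fun x y => ?_, fun x => ?_⟩
    · simp only [pow_zero, Matrix.one_apply]; split_ifs <;> norm_num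
    · simp [Matrix.one_apply]
  | succ n ih =>
    refine ⟨fun x y => ?_, fun x => ?_⟩
    · rw [pow_succ, Matrix.mul_apply]
      exact sum_nonneg fun z _ => mul_nonneg (ih.1 _ _) (hP.1 _ _)
    · simp only [pow_succ, Matrix.mul_apply]
      rw [sum_comm]
      simp only [← mul_sum, hP.2, mul_one, ih.2]

/-- `P^s(x,B)` -/
noncomputable def H (P : Matrix Ω Ω ℝ) (B : Finset Ω) (n : ℕ) (x : Ω) : ℝ :=
  ∑ y ∈ B, (P ^ n) x y

theorem H_succ (P : Matrix Ω Ω ℝ) (B : Finset Ω) (n : ℕ) (x : Ω) :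
    H P B (n + 1) x = ∑ y, P x y * H P B n y := by
  unfold H
  rw [pow_succ']
  simp only [Matrix.mul_apply, mul_sum]
  rw [sum_comm]

theorem H_nonneg {P : Matrix Ω Ω ℝ} (hP : IsTransitionMatrix P) (B : Finset Ω) (n : ℕ)
    (x : Ω) : 0 ≤ H P B n x := sum_nonneg fun _ _ => (Ppow_trans hP n).1 x _

theorem H_compl {P : Matrix Ω Ω ℝ} (hP : IsTransitionMatrix P) (B : Finset Ω) (n : ℕ)
    (x : Ω) : H P B n x + H P Bᶜ n x = 1 := by
  unfold H
  rw [sum_add_sum_compl, (Ppow_trans hP n).2]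

theorem S_le_H {P : Matrix Ω Ω ℝ} (hP : IsTransitionMatrix P) (A : Finset Ω) (n : ℕ)
    (x : Ω) : S P A n x ≤ H P Aᶜ n x := by
  induction n generalizing x with
  | zero => simp [S, H]
  | succ n ih =>
    by_cases hx : x ∈ A
    · rw [S_mem _ _ _ _ hx]; exact H_nonneg hP _ _ _
    · rw [S_succ_not _ _ _ _ hx, H_succ]
      exact sum_le_sum fun y _ => mul_le_mul_of_nonneg_left (ih y) (hP.1 x y)

theorem W_mono {P : Matrix Ω Ω ℝ} (hP : IsTransitionMatrix P) (A : Finset Ω) (x : Ω) :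
    Monotone fun n => W P A n x := by
  refine monotone_nat_of_le_succ fun n => ?_
  simp only [W, sum_range_succ]
  linarith [S_nonneg hP A n x]

theorem W_bound [Nonempty Ω] {P : Matrix Ω Ω ℝ} (hP : IsTransitionMatrix P) (A : Finset Ω)
    (N : ℕ) (r : ℝ) (hr : r < 1) (hS : ∀ x, S P A N x ≤ r) (n : ℕ) (x : Ω) :
    W P A n x ≤ N / (1 - r) := by
  obtain ⟨z, hz⟩ := Finite.exists_max (fun x => W P A n x)
  refine (hz x).trans ?_
  rw [le_div_iff₀ (by linarith)]
  have hW0 : 0 ≤ W P A n z := sum_nonneg fun s _ => S_nonneg hP A s z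
  have h1 : W P A n z ≤ W P A (N + n) z := W_mono hP A z (Nat.le_add_left _ _)
  have h2 : W P A (N + n) z = W P A N z + ∑ y, (Q P A ^ N) z y * W P A n y := by
    unfold W
    rw [sum_range_add]
    congr 1
    simp only [S_add, mul_sum]
    rw [sum_comm]
  have h3 : W P A N z ≤ N := by
    unfold W
    refine (sum_le_sum fun s _ => S_le_one hP A s z).trans ?_
    simp
  have h4 : ∑ y, (Q P A ^ N) z y * W P A n y ≤ S P A N z * W P A n z := by
    rw [← sum_add_sum_compl A, S, sum_mul]
    rw [sum_eq_zero (s := A), zero_add]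
    · exact sum_le_sum fun y _ => mul_le_mul_of_nonneg_left (hz y) (Qpow_nonneg hP A N z y)
    · intro y hy
      rw [W_mem _ _ _ _ hy, mul_zero]
  have h5 := mul_le_mul_of_nonneg_right (hS z) hW0
  nlinarith

theorem summable_of [Nonempty Ω] {P : Matrix Ω Ω ℝ} (hP : IsTransitionMatrix P) (A : Finset Ω)
    (N : ℕ) (r : ℝ) (hr : r < 1) (hS : ∀ x, S P A N x ≤ r) (x : Ω) :
    Summable fun n => S P A n x :=
  summable_of_sum_range_le (fun n => S_nonneg hP A n x) (fun n => W_bound hP A N r hr hS n x)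

theorem hit_le_of [Nonempty Ω] {P : Matrix Ω Ω ℝ} (hP : IsTransitionMatrix P) (A : Finset Ω)
    (N : ℕ) (r : ℝ) (hr : r < 1) (hS : ∀ x, S P A N x ≤ r) (x : Ω) :
    hitTime P A x ≤ N / (1 - r) := by
  rw [hitTime_eq]
  exact Real.tsum_le_of_sum_range_le (fun n => S_nonneg hP A n x)
    (fun n => W_bound hP A N r hr hS n x)

theorem summable_S {P : Matrix Ω Ω ℝ} (hP : IsTransitionMatrix P)
    (hI : IsIrreducibleChain P) (A : Finset Ω) (hA : A.Nonempty) (x : Ω) :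
    Summable fun n => S P A n x := by
  obtain ⟨a, ha⟩ := hA
  haveI : Nonempty Ω := ⟨a⟩
  choose k hk using fun x => hI x a
  have hlt : ∀ x, S P A (univ.sup k) x < 1 := by
    intro x
    have h1 : S P A (univ.sup k) x ≤ S P A (k x) x := S_anti hP A x (le_sup (mem_univ x))
    have h2 := S_le_H hP A (k x) x
    have h3 := H_compl hP A (k x) x
    have h4 : (P ^ k x) x a ≤ H P A (k x) x :=
      single_le_sum (f := fun y => (P ^ k x) x y) (fun y _ => (Ppow_trans hP _).1 x y) ha
    linarith [hk x]
  obtain ⟨z, hz⟩ := Finite.exists_max (fun x => S P A (univ.sup k) x)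
  exact summable_of hP A (univ.sup k) _ (hlt z) hz x

theorem hit_mem (P : Matrix Ω Ω ℝ) (A : Finset Ω) (x : Ω) (hx : x ∈ A) :
    hitTime P A x = 0 := by
  simp [hitTime_eq, S_mem P A _ x hx]

theorem hit_nonneg {P : Matrix Ω Ω ℝ} (hP : IsTransitionMatrix P) (A : Finset Ω) (x : Ω) :
    0 ≤ hitTime P A x := by
  rw [hitTime_eq]
  exact tsum_nonneg fun n => S_nonneg hP A n x

theorem hit_not {P : Matrix Ω Ω ℝ} (hP : IsTransitionMatrix P)
    (hI : IsIrreducibleChain P) (A : Finset Ω) (hA : A.Nonempty) (x : Ω) (hx : x ∉ A) :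
    hitTime P A x = 1 + ∑ y, P x y * hitTime P A y := by
  simp only [hitTime_eq]
  rw [(summable_S hP hI A hA x).tsum_eq_zero_add, S_zero, if_neg hx]
  congr 1
  simp only [S_succ_not P A _ x hx, ← tsum_mul_left]
  rw [Summable.tsum_finsetSum]
  intro y _
  exact (summable_S hP hI A hA y).mul_left _

theorem max_principle {P : Matrix Ω Ω ℝ} (hP : IsTransitionMatrix P)
    (hI : IsIrreducibleChain P) (A : Finset Ω) (hA : A.Nonempty) (v : Ω → ℝ) (K : ℝ)
    (h1 : ∀ x ∈ A, v x ≤ K) (h2 : ∀ x, x ∉ A → v x ≤ 1 + ∑ y, P x y * v y) (x : Ω) :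
    v x ≤ hitTime P A x + K := by
  haveI : Nonempty Ω := ⟨x⟩
  obtain ⟨z, hz⟩ := Finite.exists_max (fun x => v x - K)
  set C := v z - K with hC
  have key : ∀ n x, v x - K ≤ W P A n x + |C| * S P A n x := by
    intro n
    induction n with
    | zero =>
      intro x
      by_cases hx : x ∈ A
      · simp [W, S_zero, hx, h1 x hx]
      · have := hz x
        simp only [W, range_zero, sum_empty, S_zero, hx, if_false]
        linarith [le_abs_self C]
    | succ n ih =>
      intro x
      by_cases hx : x ∈ A
      · rw [W_mem _ _ _ _ hx, S_mem _ _ _ _ hx]; linarith [h1 x hx]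
      · rw [W_succ_not _ _ _ _ hx, S_succ_not _ _ _ _ hx]
        have h3 : ∑ y, P x y * (v y - K) ≤ ∑ y, P x y * (W P A n y + |C| * S P A n y) :=
          sum_le_sum fun y _ => mul_le_mul_of_nonneg_left (ih y) (hP.1 x y)
        have h4 : ∑ y, P x y * (v y - K) = ∑ y, P x y * v y - K := by
          simp only [mul_sub, sum_sub_distrib, ← sum_mul, hP.2, one_mul]
        have h5 : ∑ y, P x y * (W P A n y + |C| * S P A n y)
            = ∑ y, P x y * W P A n y + |C| * ∑ y, P x y * S P A n y := by
          rw [mul_sum, ← sum_add_distrib]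
          exact sum_congr rfl fun y _ => by ring
        linarith [h2 x hx]
  have hs := summable_S hP hI A hA x
  have hl : Filter.Tendsto (fun n => W P A n x + |C| * S P A n x) Filter.atTop
      (nhds (hitTime P A x + |C| * 0)) :=
    (hs.hasSum.tendsto_sum_nat).add (hs.tendsto_atTop_zero.const_mul _)
  have := ge_of_tendsto' hl (fun n => key n x)
  linarith

/-- Key inequality of Griffiths, Kang, Oliveira and Patel. -/
theorem key_ineq {P : Matrix Ω Ω ℝ} {π : Ω → ℝ} (hP : IsTransitionMatrix P)
    (hI : IsIrreducibleChain P) (hπ : IsStationaryDist P π) (A B : Finset Ω)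
    (hA : A.Nonempty) (hB : B.Nonempty) (hAB : Disjoint A B) (p D L : ℝ)
    (hp0 : 0 ≤ p) (hp1 : p ≤ 1) (hD : ∀ x ∈ A, hitTime P B x ≤ D)
    (hL : ∀ x ∈ B, L ≤ hitTime P A x) (hpe : (1 - p) * D = p * L) :
    ∑ a ∈ A, π a ≤ p := by
  set f : Ω → ℝ := fun x => (1 - p) * hitTime P B x with hf
  set g : Ω → ℝ := fun x => p * L - p * hitTime P A x with hg
  set ψ : Ω → ℝ := fun x => min (f x) (g x) with hψ
  have hPf : ∀ x, x ∉ B → ∑ y, P x y * f y = f x - (1 - p) := by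
    intro x hx
    simp only [hf]
    rw [hit_not hP hI B hB x hx, mul_add, mul_sum]
    have : ∑ y, P x y * ((1 - p) * hitTime P B y) = ∑ y, (1 - p) * (P x y * hitTime P B y) :=
      sum_congr rfl fun y _ => by ring
    linarith
  have hPg : ∀ x, x ∉ A → ∑ y, P x y * g y = g x + p := by
    intro x hx
    simp only [hg]
    rw [hit_not hP hI A hA x hx]
    simp only [mul_sub, sum_sub_distrib, ← sum_mul, hP.2, one_mul, mul_add, mul_sum]
    have : ∑ y, P x y * (p * hitTime P A y) = ∑ y, p * (P x y * hitTime P A y) :=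
      sum_congr rfl fun y _ => by ring
    linarith
  have hψf : ∀ x, ∑ y, P x y * ψ y ≤ ∑ y, P x y * f y := fun x =>
    sum_le_sum fun y _ => mul_le_mul_of_nonneg_left (min_le_left _ _) (hP.1 x y)
  have hψg : ∀ x, ∑ y, P x y * ψ y ≤ ∑ y, P x y * g y := fun x =>
    sum_le_sum fun y _ => mul_le_mul_of_nonneg_left (min_le_right _ _) (hP.1 x y)
  have hloc : ∀ x, (if x ∈ A then (1:ℝ) else 0) - p + ∑ y, P x y * ψ y - ψ x ≤ 0 := by
    intro x
    by_cases hx : x ∈ A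
    · have hxB : x ∉ B := disjoint_left.mp hAB hx
      have e : ψ x = f x := by
        refine min_eq_left ?_
        simp only [hf, hg, hit_mem P A x hx]
        have := mul_le_mul_of_nonneg_left (hD x hx) (by linarith : 0 ≤ 1 - p)
        linarith
      rw [if_pos hx, e]
      linarith [hψf x, hPf x hxB]
    · rw [if_neg hx]
      by_cases hxB : x ∈ B
      · have e : ψ x = g x := by
          refine min_eq_right ?_
          simp only [hf, hg, hit_mem P B x hxB]
          have := mul_le_mul_of_nonneg_left (hL x hxB) hp0
          linarith
        rw [e]
        linarith [hψg x, hPg x hx]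
      · rcases min_choice (f x) (g x) with e | e
        · have e' : ψ x = f x := e
          rw [e']
          linarith [hψf x, hPf x hxB]
        · have e' : ψ x = g x := e
          rw [e']
          linarith [hψg x, hPg x hx]
  have hsum : ∑ x, π x * ((if x ∈ A then (1:ℝ) else 0) - p + ∑ y, P x y * ψ y - ψ x) ≤ 0 :=
    sum_nonpos fun x _ => mul_nonpos_of_nonneg_of_nonpos (hπ.1 x) (hloc x)
  have hst : ∑ x, π x * ∑ y, P x y * ψ y = ∑ x, π x * ψ x := by
    simp only [mul_sum]
    rw [sum_comm]
    refine sum_congr rfl fun y _ => ?_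
    rw [← hπ.2.2 y, sum_mul]
    exact sum_congr rfl fun x _ => by ring
  have hA1 : ∑ x, π x * (if x ∈ A then (1:ℝ) else 0) = ∑ a ∈ A, π a := by
    simp
  simp only [mul_sub, mul_add, sum_sub_distrib, sum_add_distrib, hst, hA1, ← sum_mul,
    hπ.2.1, one_mul] at hsum
  linarith

theorem nonempty_of_meas {π : Ω → ℝ} {A : Finset Ω} {α : ℝ} (hα : 0 < α)
    (h : α ≤ ∑ a ∈ A, π a) : A.Nonempty := by
  by_contra hne
  rw [not_nonempty_iff_eq_empty] at hne
  subst hne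
  simp at h
  linarith

theorem le_Tfun (P : Matrix Ω Ω ℝ) (π : Ω → ℝ) (α : ℝ) (A : Finset Ω) (x : Ω)
    (h : α ≤ ∑ a ∈ A, π a) : hitTime P A x ≤ Tfun P π α := by
  refine le_csSup ?_ ⟨x, A, h, rfl⟩
  refine ((Set.finite_range (fun q : Ω × Finset Ω => hitTime P q.2 q.1)).subset ?_).bddAbove
  rintro r ⟨x, A, _, rfl⟩
  exact ⟨(x, A), rfl⟩

theorem one_le_T {P : Matrix Ω Ω ℝ} {π : Ω → ℝ} (hc : 2 ≤ Fintype.card Ω)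
    (hP : IsTransitionMatrix P) (hI : IsIrreducibleChain P) (hπ : IsStationaryDist P π) :
    1 ≤ Tfun P π (1/2) := by
  have hgen : ∀ (A : Finset Ω) (x : Ω), x ∉ A → 1/2 ≤ ∑ a ∈ A, π a → 1 ≤ Tfun P π (1/2) := by
    intro A x hx h
    refine le_trans ?_ (le_Tfun P π _ A x h)
    rw [hit_not hP hI A (nonempty_of_meas (by norm_num) h) x hx]
    have : 0 ≤ ∑ y, P x y * hitTime P A y :=
      sum_nonneg fun y _ => mul_nonneg (hP.1 x y) (hit_nonneg hP A y)
    linarith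
  haveI : Nontrivial Ω := Fintype.one_lt_card_iff_nontrivial.mp hc
  obtain ⟨x, y, hxy⟩ := exists_pair_ne Ω
  have hs : ∑ a ∈ {x}, π a + ∑ a ∈ ({x} : Finset Ω)ᶜ, π a = 1 := by
    rw [sum_add_sum_compl, hπ.2.1]
  by_cases h : 1/2 ≤ ∑ a ∈ {x}, π a
  · exact hgen {x} y (by simpa using hxy.symm) h
  · exact hgen {x}ᶜ x (by simp) (by linarith)

theorem hit_le_small {P : Matrix Ω Ω ℝ} {π : Ω → ℝ} (hc : 2 ≤ Fintype.card Ω)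
    (hP : IsTransitionMatrix P) (hI : IsIrreducibleChain P) (hπ : IsStationaryDist P π)
    (A : Finset Ω) (hA : 1/9 ≤ ∑ a ∈ A, π a) (x : Ω) :
    hitTime P A x ≤ 10 * Tfun P π (1/2) := by
  have hT := one_le_T hc hP hI hπ
  set T := Tfun P π (1/2) with hTdef
  have hAne : A.Nonempty := nonempty_of_meas (by norm_num) hA
  set B : Finset Ω := univ.filter fun x => 9 * T ≤ hitTime P A x with hB
  have hBc : 1/2 ≤ ∑ a ∈ Bᶜ, π a := by
    by_contra hcon
    have hs : ∑ a ∈ B, π a + ∑ a ∈ Bᶜ, π a = 1 := by rw [sum_add_sum_compl, hπ.2.1]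
    have hB2 : 1/2 ≤ ∑ a ∈ B, π a := by linarith
    have hdis : Disjoint A B := by
      rw [disjoint_left]
      intro y hy hyB
      have := (mem_filter.mp hyB).2
      rw [hit_mem P A y hy] at this
      linarith
    have := key_ineq hP hI hπ A B hAne (nonempty_of_meas (by norm_num) hB2) hdis (1/10) T (9 * T)
      (by norm_num) (by norm_num) (fun y _ => le_Tfun P π _ B y hB2)
      (fun y hy => (mem_filter.mp hy).2) (by ring)
    linarith
  have hm := max_principle hP hI Bᶜ (nonempty_of_meas (by norm_num) hBc)
    (fun x => hitTime P A x) (9 * T) ?_ ?_ x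
  · have := le_Tfun P π _ Bᶜ x hBc
    linarith
  · intro y hy
    have : ¬ (9 * T ≤ hitTime P A y) := by simpa [hB] using hy
    linarith
  · intro y hy
    have hyB : 9 * T ≤ hitTime P A y := by simpa [hB] using hy
    refine (hit_not hP hI A hAne y ?_).le
    intro hyA
    rw [hit_mem P A y hyA] at hyB
    linarith

theorem ces_upper {P : Matrix Ω Ω ℝ} {π : Ω → ℝ} (hc : 2 ≤ Fintype.card Ω)
    (hP : IsTransitionMatrix P) (hI : IsIrreducibleChain P) (hπ : IsStationaryDist P π)
    (t : ℕ) (ht : 80 * Tfun P π (1/2) ≤ t) (B : Finset Ω) (x : Ω) :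
    (∑ s ∈ range t, H P B s x) ≤ t * (∑ y ∈ B, π y + 1/4) := by
  have hT := one_le_T hc hP hI hπ
  set b := ∑ y ∈ B, π y with hb
  have hb0 : 0 ≤ b := sum_nonneg fun y _ => hπ.1 y
  have hb1 : b ≤ 1 := by
    rw [← hπ.2.1]
    exact sum_le_sum_of_subset_of_nonneg (subset_univ _) fun y _ _ => hπ.1 y
  have ht0 : (0:ℝ) < t := by linarith
  set v : Ω → ℝ := fun x => ∑ s ∈ range t, H P B s x with hv
  have hv0 : ∀ x, 0 ≤ v x := fun x => sum_nonneg fun s _ => H_nonneg hP B s x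
  have hHst : ∀ s, ∑ x, π x * H P B s x = b := by
    intro s
    induction s with
    | zero =>
      simp [H, Matrix.one_apply, hb]
    | succ s ih =>
      rw [← ih]
      simp only [H_succ, mul_sum]
      rw [sum_comm]
      refine sum_congr rfl fun y _ => ?_
      rw [← hπ.2.2 y, sum_mul]
      exact sum_congr rfl fun x _ => by ring
  have hvst : ∑ x, π x * v x = t * b := by
    simp only [hv, mul_sum]
    rw [sum_comm]
    simp [hHst]
  have hvP : ∀ x, v x ≤ 1 + ∑ y, P x y * v y := by
    intro x
    have e : ∑ y, P x y * v y = ∑ s ∈ range t, H P B (s + 1) x := by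
      simp only [hv, mul_sum, H_succ]
      rw [sum_comm]
    rw [e]
    have e2 := sum_range_succ (fun s => H P B s x) t
    rw [sum_range_succ'] at e2
    have h1 := H_compl hP B 0 x
    have h2 := H_nonneg hP Bᶜ 0 x
    have h3 := H_nonneg hP B t x
    simp only [hv]
    linarith
  set A : Finset Ω := univ.filter fun x => v x ≤ t * (b + 1/8) with hA
  have hA9 : 1/9 ≤ ∑ a ∈ A, π a := by
    have hs : ∑ a ∈ A, π a + ∑ a ∈ Aᶜ, π a = 1 := by rw [sum_add_sum_compl, hπ.2.1]
    have h1 : (∑ a ∈ Aᶜ, π a) * (t * (b + 1/8)) ≤ t * b := by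
      rw [← hvst, sum_mul, ← sum_add_sum_compl A (fun x => π x * v x)]
      have h2 : 0 ≤ ∑ x ∈ A, π x * v x := sum_nonneg fun y _ => mul_nonneg (hπ.1 y) (hv0 y)
      have h3 : ∑ x ∈ Aᶜ, π x * (t * (b + 1/8)) ≤ ∑ x ∈ Aᶜ, π x * v x := by
        refine sum_le_sum fun y hy => mul_le_mul_of_nonneg_left ?_ (hπ.1 y)
        have : ¬ (v y ≤ t * (b + 1/8)) := by
          intro hh
          exact (mem_compl.mp hy) (mem_filter.mpr ⟨mem_univ y, hh⟩)
        linarith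
      linarith
    have h4 : (∑ a ∈ Aᶜ, π a) * (b + 1/8) ≤ b := by
      refine le_of_mul_le_mul_left ?_ ht0
      linarith
    by_contra hcon
    have h5 : 8/9 < ∑ a ∈ Aᶜ, π a := by linarith
    nlinarith
  have hm := max_principle hP hI A (nonempty_of_meas (by norm_num) hA9) v (t * (b + 1/8))
    (fun y hy => (mem_filter.mp hy).2) (fun y _ => hvP y) x
  have := hit_le_small hc hP hI hπ A hA9 x
  have e : v x = ∑ s ∈ range t, H P B s x := rfl
  rw [← e]
  linarith

theorem ces_mem {P : Matrix Ω Ω ℝ} {π : Ω → ℝ} (hc : 2 ≤ Fintype.card Ω)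
    (hP : IsTransitionMatrix P) (hI : IsIrreducibleChain P) (hπ : IsStationaryDist P π)
    (t : ℕ) (ht : 80 * Tfun P π (1/2) ≤ t) :
    t ∈ {t : ℕ | 1 ≤ t ∧ ∀ (x : Ω) (A : Finset Ω),
      |(∑ s ∈ Finset.range t, ∑ y ∈ A, (P ^ s) x y) / t - ∑ y ∈ A, π y| ≤ 1/4} := by
  have hT := one_le_T hc hP hI hπ
  have ht1 : (1:ℝ) ≤ t := by linarith
  have ht0 : (0:ℝ) < t := by linarith
  refine ⟨by exact_mod_cast ht1, fun x A => ?_⟩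
  change |(∑ s ∈ range t, H P A s x) / t - ∑ y ∈ A, π y| ≤ 1/4
  have h1 := ces_upper hc hP hI hπ t ht A x
  have h2 := ces_upper hc hP hI hπ t ht Aᶜ x
  have hs : ∑ a ∈ A, π a + ∑ a ∈ Aᶜ, π a = 1 := by rw [sum_add_sum_compl, hπ.2.1]
  have h3 : ∑ s ∈ range t, H P A s x + ∑ s ∈ range t, H P Aᶜ s x = t := by
    rw [← sum_add_distrib]
    simp [H_compl hP]
  have h4 : ∑ a ∈ Aᶜ, π a = 1 - ∑ a ∈ A, π a := by linarith
  rw [h4] at h2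
  rw [abs_le]
  constructor
  · rw [le_sub_iff_add_le, le_div_iff₀ ht0]
    linarith
  · rw [sub_le_iff_le_add, div_le_iff₀ ht0]
    linarith

end CesHit

open CesHit in
theorem T_half_equiv_tCes :
    ∃ c : ℝ, 0 < c ∧
      ∀ (Ω : Type) [Fintype Ω] [DecidableEq Ω],
        ∀ (P : Matrix Ω Ω ℝ) (π : Ω → ℝ),
          2 ≤ Fintype.card Ω →
          IsTransitionMatrix P → IsIrreducibleChain P → IsStationaryDist P π →
          (tCes P π : ℝ) / c ≤ Tfun P π (1/2) ∧ Tfun P π (1/2) ≤ c * tCes P π := by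
  refine ⟨100, by norm_num, ?_⟩
  intro Ω _ _ P π hc hP hI hπ
  haveI : Nonempty Ω := Fintype.card_pos_iff.mp (by omega)
  have hT := one_le_T hc hP hI hπ
  have hmem := ces_mem hc hP hI hπ ⌈80 * Tfun P π (1/2)⌉₊ (Nat.le_ceil _)
  constructor
  · have h1 : tCes P π ≤ ⌈80 * Tfun P π (1/2)⌉₊ := Nat.sInf_le hmem
    have h2 : (tCes P π : ℝ) ≤ (⌈80 * Tfun P π (1/2)⌉₊ : ℝ) := by exact_mod_cast h1
    have h3 := Nat.ceil_lt_add_one (by linarith : 0 ≤ 80 * Tfun P π (1/2))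
    rw [div_le_iff₀ (by norm_num)]
    linarith
  · obtain ⟨ht1, ht⟩ := Nat.sInf_mem ⟨_, hmem⟩
    change 1 ≤ tCes P π at ht1
    change ∀ (x : Ω) (A : Finset Ω),
      |(∑ s ∈ Finset.range (tCes P π), H P A s x) / (tCes P π : ℕ) - ∑ y ∈ A, π y| ≤ 1/4 at ht
    set t := tCes P π with htdef
    have ht0 : (0:ℝ) < t := by exact_mod_cast ht1
    obtain ⟨x0⟩ := ‹Nonempty Ω›
    haveI : Nonempty Ω := ⟨x0⟩
    refine csSup_le ⟨_, x0, Finset.univ, ?_, rfl⟩ ?_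
    · rw [hπ.2.1]; norm_num
    · rintro r ⟨x, A, hA, rfl⟩
      have hS : ∀ x, S P A t x ≤ 3/4 := by
        intro x
        have h1 := (abs_le.mp (ht x A)).1
        have h2 : 1/4 ≤ (∑ s ∈ Finset.range t, H P A s x) / t := by linarith
        rw [le_div_iff₀ ht0] at h2
        have h3 : ∑ s ∈ Finset.range t, S P A t x ≤ ∑ s ∈ Finset.range t, (1 - H P A s x) := by
          refine Finset.sum_le_sum fun s hs => ?_
          have a1 : S P A t x ≤ S P A s x := S_anti hP A x (Finset.mem_range.mp hs).le
          linarith [S_le_H hP A s x, H_compl hP A s x]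
        rw [Finset.sum_sub_distrib] at h3
        simp only [Finset.sum_const, Finset.card_range, nsmul_eq_mul, mul_one] at h3
        refine le_of_mul_le_mul_left ?_ ht0
        linarith
      have := hit_le_of hP A t (3/4) (by norm_num) hS x
      refine this.trans ?_
      rw [div_le_iff₀ (by norm_num)]
      linarith
end

section
/- Let f : (0,1/2] → ℝ be a hittable step function and let ε > 0. Then there exists an irreducible Markov chain on a finite state space (with at least two states) such that f(α) = T(α)/T(1/2) for all α ∈ (0,1/2] ∖ Err(f,ε). -/
open Finset in
lemma hs_partial_succ {Ω : Type*} [Fintype Ω] [DecidableEq Ω] (Q : Matrix Ω Ω ℝ) (A : Finset Ω)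
    (x : Ω) (n : ℕ) :
    ∑ t ∈ range (n+1), ∑ y ∈ Aᶜ, (Q ^ t) x y =
      (∑ y ∈ Aᶜ, (1 : Matrix Ω Ω ℝ) x y) + ∑ z, Q x z * ∑ t ∈ range n, ∑ y ∈ Aᶜ, (Q ^ t) z y := by
  rw [sum_range_succ', add_comm]
  congr 1
  simp_rw [pow_succ', Matrix.mul_apply, mul_sum]
  rw [sum_comm (s := univ)]
  refine sum_congr rfl fun t _ => ?_
  rw [sum_comm]

/-- Everything needed about hitting times: supersolutions bound, exact solutions are equal. -/
lemma hs_main {Ω : Type*} [Fintype Ω] [DecidableEq Ω] (P : Matrix Ω Ω ℝ) (hP : ∀ x y, 0 ≤ P x y)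
    (A : Finset Ω) (h : Ω → ℝ) (h0 : ∀ x, 0 ≤ h x)
    (hs : ∀ x, x ∉ A → 1 + ∑ y, P x y * h y ≤ h x) :
    ∀ x, hitTime P A x ≤ h x ∧
      ((∀ x ∈ A, h x = 0 ∨ ∀ z, z ∉ A → P z x = 0) →
        (∀ x, x ∉ A → h x = 1 + ∑ y, P x y * h y) → x ∉ A → hitTime P A x = h x) := by
  intro x
  unfold hitTime
  set Q : Matrix Ω Ω ℝ := Matrix.of fun u v => if u ∈ A ∨ v ∈ A then (0:ℝ) else P u v with hQ
  have hQ0 : ∀ u v, 0 ≤ Q u v := by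
    intro u v; simp only [hQ, Matrix.of_apply]; split_ifs
    · exact le_rfl
    · exact hP u v
  have hQP : ∀ u v, Q u v ≤ P u v := by
    intro u v; simp only [hQ, Matrix.of_apply]; split_ifs
    · exact hP u v
    · exact le_rfl
  have hQpow : ∀ t u v, 0 ≤ (Q ^ t) u v := by
    intro t
    induction t with
    | zero => intro u v; simp only [pow_zero, Matrix.one_apply]; split_ifs <;> norm_num
    | succ t ih =>
      intro u v; rw [pow_succ, Matrix.mul_apply]
      exact Finset.sum_nonneg fun z _ => mul_nonneg (ih u z) (hQ0 z v)
  have hone : ∀ z, z ∉ A → ∑ y ∈ Aᶜ, (1 : Matrix Ω Ω ℝ) z y = 1 := by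
    intro z hz; simp [Matrix.one_apply, hz]
  have hone' : ∀ z, z ∈ A → ∑ y ∈ Aᶜ, (1 : Matrix Ω Ω ℝ) z y = 0 := by
    intro z hz; simp [Matrix.one_apply, hz]
  have hQA : ∀ z, z ∈ A → ∀ v, Q z v = 0 := by
    intro z hz v; simp [hQ, hz]
  have hpart : ∀ n z, ∑ t ∈ Finset.range n, ∑ y ∈ Aᶜ, (Q ^ t) z y ≤ h z := by
    intro n
    induction n with
    | zero => intro z; simpa using h0 z
    | succ n ih =>
      intro z
      rw [hs_partial_succ]
      by_cases hz : z ∈ A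
      · rw [hone' z hz]; simp [hQA z hz, h0 z]
      · rw [hone z hz]
        refine le_trans ?_ (hs z hz)
        gcongr with y _
        · exact Finset.sum_nonneg fun t _ => Finset.sum_nonneg fun w _ => hQpow t y w
        · exact hP z y
        · exact hQP z y
        · exact ih y
  have hnn : ∀ z t, 0 ≤ ∑ y ∈ Aᶜ, (Q ^ t) z y := fun z t =>
    Finset.sum_nonneg fun y _ => hQpow t z y
  have hsum : ∀ z, Summable fun t => ∑ y ∈ Aᶜ, (Q ^ t) z y := fun z =>
    summable_of_sum_range_le (hnn z) (fun n => hpart n z)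
  refine ⟨(hsum x).tsum_le_of_sum_range_le (fun n => hpart n x), ?_⟩
  intro hA heq hx
  have hrow : ∀ z, z ∉ A → ∑ y, P z y * h y = ∑ y, Q z y * h y := by
    intro z hz
    refine Finset.sum_congr rfl fun y _ => ?_
    by_cases hy : y ∈ A
    · rcases hA y hy with h1 | h1
      · simp [h1]
      · simp [h1 z hz, hQ, hy]
    · simp [hQ, hz, hy]
  -- the exact identity
  have hid : ∀ n z, z ∉ A → h z = ∑ t ∈ Finset.range n, ∑ y ∈ Aᶜ, (Q ^ t) z y
      + ∑ y, (Q ^ n) z y * h y := by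
    intro n
    induction n with
    | zero => intro z hz; simp [Matrix.one_apply]
    | succ n ih =>
      intro z hz
      rw [hs_partial_succ, hone z hz, heq z hz, hrow z hz, add_assoc]
      congr 1
      have e : ∑ y, (Q ^ (n+1)) z y * h y = ∑ w, Q z w * ∑ y, (Q ^ n) w y * h y := by
        simp_rw [pow_succ', Matrix.mul_apply, Finset.sum_mul, Finset.mul_sum]
        rw [Finset.sum_comm]
        simp_rw [mul_assoc]
      rw [e, ← Finset.sum_add_distrib]
      refine Finset.sum_congr rfl fun w _ => ?_
      rw [← mul_add]
      by_cases hw : w ∈ A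
      · simp [hQ, hw]
      · rw [← ih w hw]
  have hcol : ∀ n, ∑ y, (Q ^ n) x y * h y = ∑ y ∈ Aᶜ, (Q ^ n) x y * h y := by
    intro n
    refine (Finset.sum_subset (Finset.subset_univ _) ?_).symm
    intro y _ hy
    have hy : y ∈ A := by simpa using hy
    have : (Q ^ n) x y = 0 := by
      cases n with
      | zero =>
        have : x ≠ y := fun e => hx (e ▸ hy)
        simp [this]
      | succ n => rw [pow_succ, Matrix.mul_apply]; simp [hQ, hy]
    simp [this]
  have hlim : Filter.Tendsto (fun n => ∑ y, (Q ^ n) x y * h y) Filter.atTop (nhds 0) := by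
    have h1 := (hsum x).tendsto_atTop_zero
    have h2 := h1.mul_const (∑ y, h y)
    rw [zero_mul] at h2
    refine squeeze_zero (fun n => Finset.sum_nonneg fun y _ => mul_nonneg (hQpow n x y) (h0 y)) ?_ h2
    intro n
    rw [hcol, Finset.sum_mul]
    gcongr with y _
    · exact hQpow n x y
    · exact Finset.single_le_sum (f := h) (fun i _ => h0 i) (Finset.mem_univ y)
  have h3 := ((hsum x).hasSum.tendsto_sum_nat).add hlim
  have h4 : (fun n => ∑ t ∈ Finset.range n, ∑ y ∈ Aᶜ, (Q ^ t) x y + ∑ y, (Q ^ n) x y * h y)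
      = fun _ => h x := by
    funext n; exact (hid n x hx).symm
  rw [h4, add_zero] at h3
  exact tendsto_nhds_unique h3 tendsto_const_nhds

lemma hs_tail (M : ℕ → ℝ) (j n : ℕ) (hj : j ≤ n) :
    ∑ i ∈ Finset.range n, (if j ≤ i then M i - M (i+1) else 0) = M j - M n := by
  induction n with
  | zero => obtain rfl : j = 0 := by omega
            simp
  | succ n ih =>
    rw [Finset.sum_range_succ]
    rcases Nat.lt_or_ge n j with h | h
    · obtain rfl : j = n+1 := by omega
      rw [Finset.sum_eq_zero]
      · simp
      · intro i hi; rw [if_neg]; simp at hi; omega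
    · rw [ih h, if_pos h]; ring

lemma hs_abel (W m D U g : ℕ → ℝ) (n : ℕ) :
    (∀ i < n, U i - D (i+1) = W (i+1) - if i = 0 then 1 else 0) → (∀ i < n, m i = W i - W (i+1)) →
    1 ≤ n → ∑ i ∈ Finset.range n, U i * (g (i+1) - g i)
      + ∑ i ∈ Finset.range n, D (i+1) * (g i - g (i+1))
      = ∑ i ∈ Finset.range n, m i * g i - (g 1 - g 0) + W n * g n - W 0 * g 0 := by
  intro h1 h2 hn
  induction n, hn using Nat.le_induction with
  | base =>
    have e1 := h1 0 (by omega)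
    have e2 := h2 0 (by omega)
    simp only [if_true, zero_add] at e1 e2
    simp only [Finset.sum_range_one, zero_add]
    linear_combination (g 1 - g 0) * e1 - g 0 * e2
  | succ n hn ih =>
    have ih := ih (fun i hi => h1 i (by omega)) (fun i hi => h2 i (by omega))
    have e1 := h1 n (by omega); have e2 := h2 n (by omega)
    rw [if_neg (by omega)] at e1
    rw [Finset.sum_range_succ, Finset.sum_range_succ, Finset.sum_range_succ]
    linear_combination ih + (g (n+1) - g n) * e1 - g n * e2

def hsUp (N : ℕ) (i : Fin (N+1)) : Fin (N+1) := ⟨min (i.val+1) N, by omega⟩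
def hsDn (N : ℕ) (i : Fin (N+1)) : Fin (N+1) := ⟨i.val - 1, by omega⟩
def hsC (N : ℕ) : Fin (N+1) := ⟨min 1 N, by omega⟩

noncomputable def hsP (N : ℕ) (θ : ℝ) (u d : ℕ → ℝ) : Matrix (Fin (N+1)) (Fin (N+1)) ℝ :=
  Matrix.of fun i y => (1 - θ * (u i + d i + 1)) * (if y = i then 1 else 0)
    + θ * (u i * (if y = hsUp N i then 1 else 0) + d i * (if y = hsDn N i then 1 else 0)
      + (if y = hsC N then 1 else 0))

lemma hsP_row (N : ℕ) (θ : ℝ) (u d : ℕ → ℝ) (g : Fin (N+1) → ℝ) (i : Fin (N+1)) :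
    ∑ y, hsP N θ u d i y * g y = g i + θ * (u i * (g (hsUp N i) - g i) + d i * (g (hsDn N i) - g i)
      + (g (hsC N) - g i)) := by
  have : ∀ y, hsP N θ u d i y * g y = (1 - θ * (u i + d i + 1)) * (if y = i then g y else 0)
    + θ * (u i * (if y = hsUp N i then g y else 0) + d i * (if y = hsDn N i then g y else 0)
      + (if y = hsC N then g y else 0)) := by
    intro y
    simp only [hsP, Matrix.of_apply]
    have e : ∀ (p : Prop) [Decidable p], (if p then g y else 0) = (if p then 1 else 0) * g y := by
      intro p _; split_ifs <;> simp
    simp only [e]; ring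
  simp only [this, Finset.sum_add_distrib, ← Finset.mul_sum, Finset.sum_ite_eq', Finset.mem_univ,
    if_true]
  ring

lemma hs_core (N : ℕ) (hN : 1 ≤ N) (M Φ : ℕ → ℝ) (hM0 : M 0 = 1) (hMN : M (N+1) = 0)
    (hdec : ∀ i, i ≤ N → M (i+1) < M i) (hΦ0 : Φ 0 = -1) (hΦ1 : Φ 1 = 0)
    (hinc : ∀ i, i < N → Φ i < Φ (i+1)) (hle : ∀ i, i ≤ N → M i * (1 + Φ i) ≤ 1) :
    ∃ (θ : ℝ) (P : Matrix (Fin (N+1)) (Fin (N+1)) ℝ) (π : Fin (N+1) → ℝ), 0 < θ ∧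
      IsTransitionMatrix P ∧ IsIrreducibleChain P ∧ IsStationaryDist P π ∧
      ∀ j, 1 ≤ j → j ≤ N → ∀ α, M (j+1) + (1 - M 1) < α → α ≤ M j →
        Tfun P π α = (Φ j + 1) / θ := by
  classical
  set m : ℕ → ℝ := fun i => M i - M (i+1) with hm
  have hmpos : ∀ i, i ≤ N → 0 < m i := fun i hi => sub_pos.2 (hdec i hi)
  have hMpos : ∀ i, i ≤ N → 0 < M i := by
    intro i hi
    induction hi using Nat.decreasingInduction with
    | self => rw [← hMN]; exact hdec N le_rfl
    | of_succ i hi ih => exact ih.trans (hdec i (by omega))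
  have hΦmono : ∀ i j, i ≤ j → j ≤ N → Φ i ≤ Φ j := by
    intro i j hij
    induction j, hij using Nat.le_induction with
    | base => intro _; exact le_rfl
    | succ j hj ih => intro h; exact (ih (by omega)).trans (hinc j (by omega)).le
  set D : ℕ → ℝ := fun i => if i = 0 then 0 else (1 - M i * (1 + Φ i)) / (Φ i - Φ (i-1)) with hD
  set U : ℕ → ℝ := fun i => if i < N then D (i+1) + M (i+1) - (if i = 0 then 1 else 0) else 0 with hU
  have hD0 : ∀ i, i ≤ N → 0 ≤ D i := by
    intro i hi
    simp only [hD]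
    split_ifs with h
    · exact le_rfl
    · apply div_nonneg
      · linarith [hle i hi]
      · have := hinc (i-1) (by omega)
        rw [show i - 1 + 1 = i by omega] at this
        linarith
  have hDeq : ∀ i, 1 ≤ i → i ≤ N → D i * (Φ i - Φ (i-1)) = 1 - M i * (1 + Φ i) := by
    intro i h1 hi
    have := hinc (i-1) (by omega)
    rw [show i - 1 + 1 = i by omega] at this
    simp only [hD]
    rw [if_neg (by omega), div_mul_cancel₀]
    linarith
  have hD1 : D 1 = 1 - M 1 := by
    simp [hD, hΦ0, hΦ1]
  have hDz : D 0 = 0 := by simp [hD]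
  have hD1pos : 0 < D 1 := by
    rw [hD1]; have := hdec 0 (by omega); rw [hM0] at this; simpa using this
  have hUz : U 0 = 0 := by
    simp only [hU]; rw [if_pos (by omega)]; simp [hD1]
  have hUN : U N = 0 := by simp [hU]
  have hUi : ∀ i, i < N → U i - D (i+1) = M (i+1) - if i = 0 then 1 else 0 := by
    intro i hi; simp only [hU]; rw [if_pos hi]; ring
  have hUpos : ∀ i, 1 ≤ i → i < N → 0 < U i := by
    intro i h1 hi
    have := hUi i hi
    rw [if_neg (by omega)] at this
    linarith [hD0 (i+1) (by omega), hMpos (i+1) (by omega)]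
  have hU0 : ∀ i, i ≤ N → 0 ≤ U i := by
    intro i hi
    rcases Nat.eq_zero_or_pos i with rfl | h
    · exact hUz.ge
    rcases Nat.lt_or_ge i N with h2 | h2
    · exact (hUpos i h h2).le
    · obtain rfl : i = N := by omega
      exact hUN.ge
  set u : ℕ → ℝ := fun i => U i / m i with hu
  set d : ℕ → ℝ := fun i => D i / m i with hd
  have hmu : ∀ i, i ≤ N → m i * u i = U i := fun i hi => mul_div_cancel₀ _ (hmpos i hi).ne'
  have hmd : ∀ i, i ≤ N → m i * d i = D i := fun i hi => mul_div_cancel₀ _ (hmpos i hi).ne'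
  have hu0 : ∀ i, i ≤ N → 0 ≤ u i := fun i hi => div_nonneg (hU0 i hi) (hmpos i hi).le
  have hd0 : ∀ i, i ≤ N → 0 ≤ d i := fun i hi => div_nonneg (hD0 i hi) (hmpos i hi).le
  set K : ℝ := 1 + ∑ i ∈ Finset.range (N+1), (u i + d i) with hK
  have hnn : ∀ i ∈ Finset.range (N+1), 0 ≤ u i + d i := fun i hi => by
    have : i ≤ N := by simp at hi; omega
    exact add_nonneg (hu0 i this) (hd0 i this)
  have hKpos : 0 < K := by have := Finset.sum_nonneg hnn; linarith
  set θ : ℝ := K⁻¹ with hθ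
  have hθpos : 0 < θ := inv_pos.2 hKpos
  have hθle : ∀ i, i ≤ N → 0 ≤ 1 - θ * (u i + d i + 1) := by
    intro i hi
    have := Finset.single_le_sum hnn (Finset.mem_range.2 (Nat.lt_succ_of_le hi))
    have h2 : u i + d i + 1 ≤ K := by linarith
    have : θ * (u i + d i + 1) ≤ θ * K := by gcongr
    rw [hθ, inv_mul_cancel₀ hKpos.ne'] at this
    linarith
  have hiN : ∀ i : Fin (N+1), i.val ≤ N := fun i => by omega
  set P := hsP N θ u d with hP
  have hP0 : ∀ x y, 0 ≤ P x y := by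
    intro x y
    simp only [hP, hsP, Matrix.of_apply]
    have i0 : ∀ (p : Prop) [Decidable p], (0:ℝ) ≤ if p then 1 else 0 := by
      intro p _; split_ifs <;> norm_num
    have h1 := hθle x (hiN x); have h2 := hu0 x (hiN x); have h3 := hd0 x (hiN x)
    exact add_nonneg (mul_nonneg h1 (i0 _)) (mul_nonneg hθpos.le
      (add_nonneg (add_nonneg (mul_nonneg h2 (i0 _)) (mul_nonneg h3 (i0 _))) (i0 _)))
  have hPge : ∀ x y : Fin (N+1), θ * (u x * (if y = hsUp N x then 1 else 0)
      + d x * (if y = hsDn N x then 1 else 0) + (if y = hsC N then 1 else 0)) ≤ P x y := by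
    intro x y
    simp only [hP, hsP, Matrix.of_apply]
    have : 0 ≤ (1 - θ * (u x + d x + 1)) * (if y = x then 1 else 0) :=
      mul_nonneg (hθle x (hiN x)) (by split_ifs <;> norm_num)
    linarith
  have hPC : ∀ x, 0 < P x (hsC N) := by
    intro x
    refine lt_of_lt_of_le ?_ (hPge x (hsC N))
    have h2 := hu0 x (hiN x); have h3 := hd0 x (hiN x)
    apply mul_pos hθpos
    rw [if_pos (rfl : hsC N = hsC N)]
    have : 0 ≤ u x * (if hsC N = hsUp N x then 1 else 0) := mul_nonneg h2 (by split_ifs <;> norm_num)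
    have : 0 ≤ d x * (if hsC N = hsDn N x then 1 else 0) := mul_nonneg h3 (by split_ifs <;> norm_num)
    linarith
  have hPup : ∀ x : Fin (N+1), 1 ≤ x.val → x.val < N → 0 < P x (hsUp N x) := by
    intro x h1 hx
    refine lt_of_lt_of_le ?_ (hPge x _)
    have h2 : 0 < u x := div_pos (hUpos x h1 hx) (hmpos x (hiN x))
    have h3 := hd0 x (hiN x)
    apply mul_pos hθpos
    rw [if_pos (rfl : hsUp N x = hsUp N x)]
    have : 0 ≤ d x * (if hsUp N x = hsDn N x then 1 else 0) := mul_nonneg h3 (by split_ifs <;> norm_num)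
    have : (0:ℝ) ≤ (if hsUp N x = hsC N then 1 else 0) := by split_ifs <;> norm_num
    linarith
  have hPdn : 0 < P (hsC N) (hsDn N (hsC N)) := by
    refine lt_of_lt_of_le ?_ (hPge _ _)
    have hc : (hsC N).val = 1 := by simp [hsC, hN]
    have h2 : 0 < d (hsC N).val := by rw [hc]; exact div_pos hD1pos (hmpos 1 hN)
    have h3 := hu0 _ (hiN (hsC N))
    apply mul_pos hθpos
    rw [if_pos (rfl : hsDn N (hsC N) = hsDn N (hsC N))]
    have : 0 ≤ u (hsC N).val * (if hsDn N (hsC N) = hsUp N (hsC N) then 1 else 0) :=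
      mul_nonneg h3 (by split_ifs <;> norm_num)
    have : (0:ℝ) ≤ (if hsDn N (hsC N) = hsC N then 1 else 0) := by split_ifs <;> norm_num
    linarith
  have hPpow : ∀ n x y, 0 ≤ (P ^ n) x y := by
    intro n
    induction n with
    | zero => intro u v; simp only [pow_zero, Matrix.one_apply]; split_ifs <;> norm_num
    | succ t ih =>
      intro u v; rw [pow_succ, Matrix.mul_apply]
      exact Finset.sum_nonneg fun z _ => mul_nonneg (ih u z) (hP0 z v)
  have hstep : ∀ n x y z, 0 < (P ^ n) x y → 0 < P y z → 0 < (P ^ (n+1)) x z := by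
    intro n x y z h1 h2
    rw [pow_succ, Matrix.mul_apply]
    exact lt_of_lt_of_le (mul_pos h1 h2) (Finset.single_le_sum
      (f := fun w => (P ^ n) x w * P w z) (fun w _ => mul_nonneg (hPpow n x w) (hP0 w z))
      (Finset.mem_univ y))
  have hc1 : (hsC N).val = 1 := by simp [hsC, hN]
  refine ⟨θ, P, fun i => m i, hθpos, ⟨hP0, ?_⟩, ?_, ⟨fun i => (hmpos i (hiN i)).le, ?_, ?_⟩, ?_⟩
  · intro x
    have := hsP_row N θ u d (fun _ => 1) x
    simpa using this
  · intro x
    have hxC : 0 < (P ^ 1) x (hsC N) := by rw [pow_one]; exact hPC x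
    have hup : ∀ i (h1 : 1 ≤ i) (h : i < N+1), ∃ n : ℕ, 0 < (P ^ n) x ⟨i, h⟩ := by
      intro i h1
      induction i, h1 using Nat.le_induction with
      | base =>
        intro h
        refine ⟨1, ?_⟩
        rwa [show (⟨1, h⟩ : Fin (N+1)) = hsC N from Fin.ext hc1.symm]
      | succ i hi ih =>
        intro h
        obtain ⟨n, hn⟩ := ih (by omega)
        refine ⟨n+1, hstep n _ _ _ hn ?_⟩
        have := hPup ⟨i, by omega⟩ hi (by simp; omega)
        rwa [show hsUp N ⟨i, by omega⟩ = (⟨i+1, h⟩ : Fin (N+1)) from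
          Fin.ext (by simp [hsUp]; omega)] at this
    intro y
    rcases Nat.eq_zero_or_pos y.val with h | h
    · refine ⟨2, hstep 1 _ _ _ hxC ?_⟩
      rwa [show hsDn N (hsC N) = y from Fin.ext (by simp [hsDn, hc1, h])] at hPdn
    · exact hup y.val h y.isLt
  · rw [Fin.sum_univ_eq_sum_range m (N+1)]
    have := hs_tail M 0 (N+1) (by omega)
    simpa only [hM0, hMN, zero_le, if_true, sub_zero] using this
  · intro y
    set gn : ℕ → ℝ := fun n => if n = y.val then 1 else 0 with hgn
    have hrow : ∀ x : Fin (N+1), m x * P x y = m x * gn x + θ * (U x * (gn (x.val+1) - gn x)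
        + D x * (gn (x.val-1) - gn x) + m x * (gn 1 - gn x)) := by
      intro x
      have := hsP_row N θ u d (fun z => gn z) x
      have e : ∑ z, hsP N θ u d x z * gn z = P x y := by
        simp [hgn, hP, ← Fin.ext_iff]
      rw [e] at this
      have e2 : U x * (gn (hsUp N x) - gn x) = U x * (gn (x.val+1) - gn x) := by
        rcases Nat.lt_or_ge x.val N with h | h
        · rw [show (hsUp N x).val = x.val+1 by simp [hsUp]; omega]
        · have : x.val = N := by omega
          rw [this, hUN]; simp
      rw [this, ← e2, ← hmu x (hiN x), ← hmd x (hiN x), hc1]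
      simp only [hsDn]
      ring
    simp only [hrow]
    rw [Fin.sum_univ_eq_sum_range (fun x => m x * gn x + θ * (U x * (gn (x+1) - gn x)
        + D x * (gn (x-1) - gn x) + m x * (gn 1 - gn x))) (N+1)]
    have hA := hs_abel M m D U gn N hUi (fun i _ => rfl) hN
    have hsm : ∑ x ∈ Finset.range (N+1), m x = 1 := by
      have := hs_tail M 0 (N+1) (by omega)
      simpa only [hM0, hMN, zero_le, if_true, sub_zero] using this
    have hDs : ∑ x ∈ Finset.range (N+1), D x * (gn (x-1) - gn x)
        = ∑ i ∈ Finset.range N, D (i+1) * (gn i - gn (i+1)) := by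
      rw [Finset.sum_range_succ']; simp [hDz]
    have hUs : ∑ x ∈ Finset.range (N+1), U x * (gn (x+1) - gn x)
        = ∑ x ∈ Finset.range N, U x * (gn (x+1) - gn x) := by
      rw [Finset.sum_range_succ, hUN]; simp
    have hms : ∑ x ∈ Finset.range (N+1), m x * gn x
        = ∑ x ∈ Finset.range N, m x * gn x + M N * gn N := by
      rw [Finset.sum_range_succ]; simp [hm, hMN]
    have hmy : ∑ x ∈ Finset.range (N+1), m x * gn x = m y := by
      simp only [hgn, mul_ite, mul_one, mul_zero, Finset.sum_ite_eq', Finset.mem_range]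
      rw [if_pos y.isLt]
    have hm1 : ∑ x ∈ Finset.range (N+1), m x * (gn 1 - gn x)
        = gn 1 - ∑ x ∈ Finset.range (N+1), m x * gn x := by
      simp only [mul_sub, Finset.sum_sub_distrib, ← Finset.sum_mul, hsm, one_mul]
    rw [Finset.sum_add_distrib, ← Finset.mul_sum, Finset.sum_add_distrib, Finset.sum_add_distrib,
      hm1, hmy, hDs, hUs]
    rw [hms] at hmy
    linear_combination θ * hA + θ * hmy - θ * gn 0 * hM0
  · -- hitting times
    set hf : ℕ → ℕ → ℝ := fun j i => if i ≤ j then Φ j - Φ i else Φ j + 1 with hhf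
    have hf0 : ∀ j, 1 ≤ j → j ≤ N → ∀ i, 0 ≤ hf j i := by
      intro j h1 hj i
      simp only [hhf]; split_ifs with h
      · linarith [hΦmono i j h hj]
      · linarith [hΦmono 1 j h1 hj]
    have hfle : ∀ j, j ≤ N → ∀ i, hf j i ≤ Φ j + 1 := by
      intro j hj i
      simp only [hhf]; split_ifs with h
      · linarith [hΦmono 0 i (by omega) (by omega)]
      · exact le_rfl
    -- row identity
    have hrow : ∀ j (x : Fin (N+1)), 1 + ∑ y, P x y * (hf j y / θ) = hf j x / θ + (1 +
        (u x * (hf j (hsUp N x) - hf j x) + d x * (hf j (hsDn N x) - hf j x)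
          + (hf j 1 - hf j x))) := by
      intro j x
      have := hsP_row N θ u d (fun z => hf j z / θ) x
      rw [this, hc1]
      field_simp
      ring
    have hlow : ∀ j, 1 ≤ j → j ≤ N → ∀ x : Fin (N+1), x.val < j →
        1 + ∑ y, P x y * (hf j y / θ) = hf j x / θ := by
      intro j h1 hj x hx
      rw [hrow]
      have hxm := hmpos x (hiN x)
      suffices h : m x * (1 + (u x * (hf j (hsUp N x) - hf j x) + d x * (hf j (hsDn N x) - hf j x)
          + (hf j 1 - hf j x))) = 0 by
        rw [(mul_eq_zero.1 h).resolve_left hxm.ne', add_zero]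
      have e1 : hf j (hsUp N x) = Φ j - Φ (x.val+1) := by
        rw [show (hsUp N x).val = x.val+1 by simp [hsUp]; omega]
        simp only [hhf]; rw [if_pos (by omega)]
      have e2 : hf j (hsDn N x) = Φ j - Φ (x.val-1) := by
        simp only [hhf, hsDn]; rw [if_pos (by omega)]
      have e3 : hf j 1 = Φ j - Φ 1 := by
        simp only [hhf]; rw [if_pos (by omega)]
      have e4 : hf j x = Φ j - Φ x := by
        simp only [hhf]; rw [if_pos (by omega)]
      rw [e1, e2, e3, e4]
      have hu' := hmu x (hiN x)
      have hd' := hmd x (hiN x)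
      have goal' : m x + (U x * (Φ x - Φ (x.val+1)) + D x * (Φ x - Φ (x.val - 1)) + m x * Φ x) = 0 := by
        rcases Nat.eq_zero_or_pos x.val with h | h
        · rw [h, hUz, hDz, hΦ0]; ring
        · have q1 := hDeq x h (hiN x)
          have q2 := hDeq (x.val+1) (by omega) (by omega)
          have q3 := hUi x (by omega)
          rw [if_neg (by omega)] at q3
          rw [Nat.add_sub_cancel] at q2
          have q4 : m x = M x - M (x.val+1) := rfl
          linear_combination q1 - q2 + (Φ x - Φ (x.val+1)) * q3 + (1 + Φ x) * q4
      linear_combination goal' + (Φ x - Φ (x.val+1)) * hu' + (Φ x - Φ (x.val-1)) * hd' - m x * hΦ1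
    have hhigh : ∀ j, 1 ≤ j → j ≤ N → ∀ x : Fin (N+1), x.val ≠ j →
        1 + ∑ y, P x y * (hf j y / θ) ≤ hf j x / θ := by
      intro j h1 hj x hx
      rcases Nat.lt_or_ge x.val j with h | h
      · exact (hlow j h1 hj x h).le
      rw [hrow]
      have e4 : hf j x = Φ j + 1 := by
        simp only [hhf]; rw [if_neg (by omega)]
      have e3 : hf j 1 = Φ j := by
        simp only [hhf]; rw [if_pos (by omega), hΦ1, sub_zero]
      have q1 : u x * (hf j (hsUp N x) - hf j x) ≤ 0 :=
        mul_nonpos_of_nonneg_of_nonpos (hu0 x (hiN x)) (by rw [e4]; linarith [hfle j hj (hsUp N x)])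
      have q2 : d x * (hf j (hsDn N x) - hf j x) ≤ 0 :=
        mul_nonpos_of_nonneg_of_nonpos (hd0 x (hiN x)) (by rw [e4]; linarith [hfle j hj (hsDn N x)])
      have q3 : hf j 1 - hf j x = -1 := by rw [e3, e4]; ring
      linarith
    have hub : ∀ j, 1 ≤ j → j ≤ N → ∀ (A : Finset (Fin (N+1))) (c : Fin (N+1)), c ∈ A → c.val = j →
        ∀ x, hitTime P A x ≤ (Φ j + 1) / θ := by
      intro j h1 hj A c hcA hc x
      refine ((hs_main P hP0 A (fun i => hf j i / θ) (fun i => div_nonneg (hf0 j h1 hj i) hθpos.le)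
        (fun y hy => hhigh j h1 hj y ?_)) x).1.trans ?_
      · intro h; exact hy ((Fin.ext (h.trans hc.symm) : y = c) ▸ hcA)
      · gcongr; exact hfle j hj x
    intro j h1 hj α hα1 hα2
    refine IsGreatest.csSup_eq ⟨?_, ?_⟩
    · set A : Finset (Fin (N+1)) := Finset.univ.filter fun i => j ≤ i.val with hA
      refine ⟨0, A, ?_, ?_⟩
      · rw [hA, Finset.sum_filter,
          Fin.sum_univ_eq_sum_range (fun i => if j ≤ i then m i else 0) (N+1),
          hs_tail M j (N+1) (by omega), hMN]
        simpa using hα2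
      · have hmem : ∀ z : Fin (N+1), z ∉ A ↔ z.val < j := by simp [hA]
        have := ((hs_main P hP0 A (fun i => hf j i / θ)
          (fun i => div_nonneg (hf0 j h1 hj i) hθpos.le)
          (fun y hy => (hlow j h1 hj y ((hmem y).1 hy)).le)) 0).2 ?_
          (fun y hy => (hlow j h1 hj y ((hmem y).1 hy)).symm) ((hmem 0).2 (by simp; omega))
        · rw [this]; simp [hhf, hΦ0]
        · intro z hz
          have hz : j ≤ z.val := by simpa [hA] using hz
          rcases Nat.eq_or_lt_of_le hz with h | h
          · left; simp [hhf, h]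
          · right
            intro w hw
            have hw := (hmem w).1 hw
            simp only [hP, hsP, Matrix.of_apply]
            rw [if_neg, if_neg, if_neg, if_neg]
            · ring
            · intro e; have := congrArg Fin.val e; rw [hc1] at this; omega
            · intro e; have := congrArg Fin.val e; simp [hsDn] at this; omega
            · intro e; have := congrArg Fin.val e; simp [hsUp] at this; omega
            · intro e; have := congrArg Fin.val e; omega
    · rintro r ⟨x, A, hAm, rfl⟩
      by_cases hex : ∃ c ∈ A, 1 ≤ c.val ∧ c.val ≤ j
      · obtain ⟨c, hcA, hc1', hcj⟩ := hex
        refine (hub c.val hc1' (hiN c) A c hcA rfl x).trans ?_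
        have := hΦmono c.val j hcj hj
        gcongr
      · exfalso
        push Not at hex
        have : ∑ a ∈ A, m a ≤ ∑ a : Fin (N+1), ((if j+1 ≤ a.val then m a else 0)
            + if a.val = 0 then m a else 0) := by
          have e : ∑ a ∈ A, m a ≤ ∑ a ∈ A, ((if j+1 ≤ a.val then m a else 0)
            + if a.val = 0 then m a else 0) := by
            refine Finset.sum_le_sum fun a ha => ?_
            have q := hex a ha
            rcases Nat.eq_zero_or_pos a.val with h | h
            · rw [if_neg (by omega), if_pos h]; simp
            · rw [if_pos (by have := q h; omega), if_neg (by omega)]; simp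
          refine e.trans (Finset.sum_le_sum_of_subset_of_nonneg (Finset.subset_univ _) ?_)
          intro a _ _
          have := (hmpos a (hiN a)).le
          apply add_nonneg <;> split_ifs <;> first | exact this | exact le_rfl
        rw [Finset.sum_add_distrib,
          Fin.sum_univ_eq_sum_range (fun i => if j+1 ≤ i then m i else 0) (N+1),
          hs_tail M (j+1) (N+1) (by omega), hMN,
          Fin.sum_univ_eq_sum_range (fun i => if i = 0 then m i else 0) (N+1)] at this
        have e : ∑ i ∈ Finset.range (N+1), (if i = 0 then m i else 0) = 1 - M 1 := by
          simp [hm, hM0]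
        rw [e] at this
        linarith


/-- For every hittable step function
`f(α) = 1 + ∑_{i=1}^k λ_i·𝟙{α ≤ α_i}` (positive `λ_i`, `0 < α_k < ⋯ < α_1 < 1/2` and
`∑_{j=1}^i λ_j ≤ α_i⁻¹ − 1` for all `i`) and every `ε > 0`, there is an irreducible Markov
chain on a finite state space (with at least two states) such that `f(α) = T(α)/T(1/2)`
for all `α ∈ (0,1/2] ∖ Err(f,ε)`, where `Err(f,ε) = ∪_{i=0}^k [α_i, α_i + ε]` with `α_0 = 0`. -/
theorem hittable_step_function_realized (k : ℕ) (lam a : ℕ → ℝ)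
    (hlam : ∀ i, 1 ≤ i → i ≤ k → 0 < lam i)
    (ha : ∀ i, 1 ≤ i → i ≤ k → 0 < a i ∧ a i < 1/2)
    (hanti : ∀ i j, 1 ≤ i → i < j → j ≤ k → a j < a i)
    (hhit : ∀ i, 1 ≤ i → i ≤ k → ∑ j ∈ Finset.Icc 1 i, lam j ≤ (a i)⁻¹ - 1)
    (ε : ℝ) (hε : 0 < ε) :
    ∃ (n : ℕ) (P : Matrix (Fin n) (Fin n) ℝ) (π : Fin n → ℝ),
      2 ≤ n ∧ IsTransitionMatrix P ∧ IsIrreducibleChain P ∧ IsStationaryDist P π ∧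
      ∀ α ∈ Set.Ioc (0:ℝ) (1/2),
        α ∉ (Set.Icc (0:ℝ) ε ∪ ⋃ i ∈ Finset.Icc 1 k, Set.Icc (a i) (a i + ε)) →
        1 + ∑ i ∈ Finset.Icc 1 k, (if α ≤ a i then lam i else 0) =
          Tfun P π α / Tfun P π (1/2) := by
  set b : ℝ := if 1 ≤ k then a 1 else 0 with hb
  have hb2 : b < 1/2 := by
    rw [hb]; split_ifs with h
    · exact (ha 1 le_rfl h).2
    · norm_num
  have hb0 : 0 ≤ b := by
    rw [hb]; split_ifs with h
    · exact (ha 1 le_rfl h).1.le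
    · exact le_rfl
  set δ : ℝ := min (ε/2) ((1/2 - b)/2) with hδ
  have hδ0 : 0 < δ := lt_min (by linarith) (by linarith)
  have hδε : δ ≤ ε/2 := min_le_left _ _
  have hδb : δ ≤ (1/2 - b)/2 := min_le_right _ _
  set M : ℕ → ℝ := fun i => if i = 0 then 1 else if i = 1 then 1 - δ else
    if i ≤ k+1 then a (i-1) else 0 with hM
  set Φ : ℕ → ℝ := fun i => if i = 0 then -1 else ∑ j ∈ Finset.Icc 1 (i-1), lam j with hΦ
  have hM0 : M 0 = 1 := by simp [hM]
  have hM1 : M 1 = 1 - δ := by simp [hM]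
  have hM2 : M 2 = b := by
    simp only [hM, hb]
    by_cases h : 1 ≤ k <;> simp [h]
  have hMi : ∀ i, 1 ≤ i → i ≤ k → M (i+1) = a i := by
    intro i h1 hi
    simp only [hM]
    rw [if_neg (by omega), if_neg (by omega), if_pos (by omega), Nat.add_sub_cancel]
  have hMN : M (k+1+1) = 0 := by simp [hM]
  have hΦi : ∀ i, Φ (i+1) = ∑ j ∈ Finset.Icc 1 i, lam j := by intro i; simp [hΦ]
  have hdec : ∀ i, i ≤ k+1 → M (i+1) < M i := by
    intro i hi
    rcases i with _ | _ | i
    · simp only [zero_add]; rw [hM0, hM1]; linarith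
    · simp only [zero_add]; rw [hM1, hM2]; linarith
    · rw [hMi (i+1) (by omega) (by omega)]
      rcases Nat.lt_or_ge (i+1) k with h | h
      · rw [hMi (i+1+1) (by omega) (by omega)]
        exact hanti _ _ (by omega) (by omega) (by omega)
      · obtain rfl : i+1 = k := by omega
        rw [hMN]; exact (ha (i+1) (by omega) le_rfl).1
  obtain ⟨θ, P, π, hθ, hT, hI, hS, hmain⟩ := hs_core (k+1) (by omega) M Φ hM0 hMN hdec
    (by simp [hΦ]) (by simp [hΦ])
    (by
      intro i hi
      rcases i with _ | i
      · simp [hΦ]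
      · rw [hΦi, hΦi, Finset.sum_Icc_succ_top (by omega)]
        linarith [hlam (i+1) (by omega) (by omega)])
    (by
      intro i hi
      rcases i with _ | _ | i
      · simp [hΦ]
      · simp only [zero_add]; rw [hM1]; simp [hΦ]; linarith
      · rw [hΦi, hMi (i+1) (by omega) (by omega)]
        have h1 := hhit (i+1) (by omega) (by omega)
        have h2 := (ha (i+1) (by omega) (by omega)).1
        calc a (i+1) * (1 + ∑ j ∈ Finset.Icc 1 (i+1), lam j)
            ≤ a (i+1) * (a (i+1))⁻¹ := by gcongr; linarith
          _ = 1 := mul_inv_cancel₀ h2.ne')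
  refine ⟨k+1+1, P, π, by omega, hT, hI, hS, ?_⟩
  have hhalf : Tfun P π (1/2) = 1/θ := by
    rw [hmain 1 le_rfl (by omega) (1/2) (by simp only [Nat.reduceAdd]; rw [hM1, hM2]; linarith)
      (by rw [hM1]; linarith)]
    simp [hΦ]
  intro α hα hnot
  simp only [Set.mem_union, Set.mem_iUnion, not_or, not_exists, Set.mem_Icc, not_and, not_le,
    Finset.mem_Icc] at hnot
  obtain ⟨hn0, hni⟩ := hnot
  have hαε := hn0 hα.1.le
  -- number of steps above α
  set j := Nat.findGreatest (fun j => j = 0 ∨ α ≤ a j) k with hj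
  have hjk : j ≤ k := Nat.findGreatest_le k
  have hjspec : j = 0 ∨ α ≤ a j :=
    Nat.findGreatest_spec (P := fun j => j = 0 ∨ α ≤ a j) (Nat.zero_le k) (Or.inl rfl)
  have hjgt : ∀ i, j < i → i ≤ k → a i < α := by
    intro i h1 h2
    have := Nat.findGreatest_is_greatest (P := fun j => j = 0 ∨ α ≤ a j) h1 h2
    push Not at this
    exact this.2
  have hsum : ∑ i ∈ Finset.Icc 1 k, (if α ≤ a i then lam i else 0)
      = ∑ i ∈ Finset.Icc 1 j, lam i := by
    rw [← Finset.sum_filter]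
    congr 1
    ext i
    simp only [Finset.mem_filter, Finset.mem_Icc]
    constructor
    · rintro ⟨⟨h1, h2⟩, h3⟩
      refine ⟨h1, ?_⟩
      by_contra h
      exact absurd h3 (not_le.2 (hjgt i (by omega) h2))
    · rintro ⟨h1, h2⟩
      refine ⟨⟨h1, by omega⟩, ?_⟩
      have h3 : α ≤ a j := hjspec.resolve_left (by omega)
      rcases Nat.eq_or_lt_of_le h2 with h | h
      · rw [h]; exact h3
      · exact h3.trans (hanti i j h1 h hjk).le
  have hTα : Tfun P π α = (Φ (j+1) + 1)/θ := by
    refine hmain (j+1) (by omega) (by omega) α ?_ ?_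
    · rw [hM1]
      rcases Nat.lt_or_ge j k with h | h
      · rw [hMi (j+1) (by omega) (by omega)]
        have := hni (j+1) ⟨by omega, by omega⟩ (hjgt (j+1) (by omega) (by omega)).le
        linarith
      · have e : j = k := by omega
        rw [e, hMN]; linarith
    · rcases Nat.eq_zero_or_pos j with h | h
      · rw [h, zero_add, hM1]; have := hα.2; linarith
      · rw [hMi j h hjk]; exact hjspec.resolve_left (by omega)
  rw [hsum, hTα, hhalf, hΦi]
  field_simp
  ring
end
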